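/- Let a_1, ..., a_7 and b_1, ..., b_7 be integers with a_i ≥ 1 for each i, such that the product of all a_i times the product over 1 ≤ t < s ≤ 7 of (a_t·b_s - a_s·b_t) is nonzero, and such that the polynomial value ∏_{i=1}^{7}(a_i·n + b_i) has no fixed prime divisor (i.e., for every prime p there exists a positive integer n with p not dividing ∏_{i=1}^{7}(a_i·n + b_i)). Then there exist δ > 0 and x_0 such that for all x ≥ x_0, the number of positive integers n ≤ x for which ∏_{i=1}^{7}(a_i·n + b_i) is positive and has at most 27 prime factors counted with multiplicity is at least δ·x/(log x)^7. -/

import Mathlib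

section

open Finset ArithmeticFunction

/-- The summand `log p / p` of Mertens' first theorem, extended by zero to all naturals. -/
noncomputable def mertensTerm (n : ℕ) : ℝ := if n.Prime then Real.log n / n else 0

lemma mertensTerm_nonneg (n : ℕ) : 0 ≤ mertensTerm n := by
  unfold mertensTerm
  split_ifs
  · positivity
  · exact le_rfl

lemma summable_log_div_sq : Summable (fun n : ℕ => Real.log n / (n : ℝ) ^ 2) := by
  have h : Summable (fun n : ℕ => 2 * (n : ℝ) ^ (-(3 / 2) : ℝ)) :=
    (Real.summable_nat_rpow.2 (by norm_num)).mul_left 2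
  refine Summable.of_nonneg_of_le (fun n => by positivity) (fun n => ?_) h
  rcases Nat.eq_zero_or_pos n with rfl | hn
  · simp
  have hn' : (0 : ℝ) < n := by exact_mod_cast hn
  have h1 := Real.log_le_rpow_div hn'.le (show (0 : ℝ) < 1 / 2 by norm_num)
  rw [div_le_iff₀ (by positivity)]
  have h2 : (n : ℝ) ^ (-(3 / 2) : ℝ) * (n : ℝ) ^ 2 = (n : ℝ) ^ (1 / 2 : ℝ) := by
    rw [← Real.rpow_natCast, ← Real.rpow_add hn']
    norm_num
  nlinarith

/-- A bound for the partial sums of `log n / n ^ 2`. -/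
lemma exists_sum_log_div_sq_le :
    ∃ K : ℝ, 0 < K ∧ ∀ s : Finset ℕ, ∑ n ∈ s, Real.log n / (n : ℝ) ^ 2 ≤ K := by
  refine ⟨(∑' n : ℕ, Real.log n / (n : ℝ) ^ 2) + 1, ?_, fun s => ?_⟩
  · have : 0 ≤ ∑' n : ℕ, Real.log n / (n : ℝ) ^ 2 := tsum_nonneg fun n => by positivity
    linarith
  · have := summable_log_div_sq.sum_le_tsum s (fun n _ => by positivity)
    linarith

lemma log_factorial_eq_sum_primesLE (n : ℕ) :
    Real.log (n.factorial : ℝ) =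
      ∑ p ∈ Nat.primesLE n, (n.factorial.factorization p : ℝ) * Real.log p := by
  have h := Nat.prod_factorization_pow_eq_self (Nat.factorial_ne_zero n)
  have hs : n.factorial.factorization.support ⊆ Nat.primesLE n := by
    intro p hp
    rw [Nat.support_factorization, Nat.mem_primeFactors] at hp
    exact Nat.mem_primesLE.2 ⟨(hp.1.dvd_factorial).1 hp.2.1, hp.1⟩
  rw [Finsupp.prod_of_support_subset _ hs _ (by simp)] at h
  conv_lhs => rw [← h]
  push_cast
  rw [Real.log_prod (fun p hp => ?_)]
  · refine sum_congr rfl fun p _ => by rw [Real.log_pow]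
  · have := (Nat.mem_primesLE.1 hp).2.pos
    positivity

lemma sum_mertensTerm_eq (n : ℕ) :
    ∑ i ∈ Ioc 0 n, mertensTerm i = ∑ p ∈ Nat.primesLE n, Real.log p / p := by
  rw [Nat.primesLE_eq_filter_Ioc_zero, sum_filter]
  rfl

/-- Mertens' first theorem. -/
theorem exists_abs_sum_mertensTerm_sub_log_le :
    ∃ C : ℝ, 1 ≤ C ∧ ∀ n : ℕ, 1 ≤ n → |∑ i ∈ Ioc 0 n, mertensTerm i - Real.log n| ≤ C := by
  obtain ⟨K, hK0, hK⟩ := exists_sum_log_div_sq_le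
  refine ⟨2 + 2 * K, by linarith, fun n hn => ?_⟩
  have hn' : (0 : ℝ) < n := by exact_mod_cast hn
  rw [sum_mertensTerm_eq, abs_le]
  constructor
  · have h1 : (n : ℝ) * Real.log n - n ≤ Real.log (n.factorial : ℝ) := by
      have h := Stirling.le_log_factorial_stirling (n := n) (by omega)
      have h2 : 0 ≤ Real.log n := Real.log_natCast_nonneg n
      have h3 : 0 ≤ Real.log (2 * Real.pi) := Real.log_nonneg (by linarith [Real.pi_gt_three])
      linarith
    have h2 : Real.log (n.factorial : ℝ) ≤
        n * ∑ p ∈ Nat.primesLE n, (Real.log p / p + 2 * (Real.log p / (p : ℝ) ^ 2)) := by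
      rw [log_factorial_eq_sum_primesLE, mul_sum]
      refine sum_le_sum fun p hp => ?_
      have hp := (Nat.mem_primesLE.1 hp).2
      have hp2 : (2 : ℝ) ≤ p := by exact_mod_cast hp.two_le
      have hlog : 0 ≤ Real.log p := Real.log_natCast_nonneg p
      have h3 : (n.factorial.factorization p : ℝ) ≤ n / ((p : ℝ) - 1) := by
        have h4 : ((n / (p - 1) : ℕ) : ℝ) ≤ (n : ℝ) / ((p - 1 : ℕ) : ℝ) := Nat.cast_div_le
        rw [Nat.cast_sub hp.one_le, Nat.cast_one] at h4
        exact le_trans (by exact_mod_cast Nat.factorization_factorial_le_div_pred hp n) h4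
      have h5 : (1 : ℝ) / (p - 1) ≤ 1 / p + 2 / (p : ℝ) ^ 2 := by
        rw [div_add_div _ _ (by positivity) (by positivity), div_le_div_iff₀ (by linarith)
          (by positivity)]
        nlinarith
      calc (n.factorial.factorization p : ℝ) * Real.log p
          ≤ (n / ((p : ℝ) - 1)) * Real.log p := by gcongr
        _ = n * Real.log p * (1 / ((p : ℝ) - 1)) := by ring
        _ ≤ n * Real.log p * (1 / p + 2 / (p : ℝ) ^ 2) := by gcongr
        _ = _ := by ring
    rw [sum_add_distrib, ← mul_sum] at h2
    have h6 := hK (Nat.primesLE n)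
    have h7 := h1.trans h2
    have h8 : Real.log n - 1 ≤ ∑ p ∈ Nat.primesLE n, Real.log p / (p : ℝ) +
        2 * ∑ p ∈ Nat.primesLE n, Real.log p / (p : ℝ) ^ 2 := by
      refine le_of_mul_le_mul_left ?_ hn'
      linarith
    linarith
  · have h1 : Real.log (n.factorial : ℝ) ≤ n * Real.log n := by
      rw [← Real.log_pow]
      refine Real.log_le_log (by positivity) ?_
      exact_mod_cast Nat.factorial_le_pow n
    have h2 : n * ∑ p ∈ Nat.primesLE n, Real.log p / (p : ℝ) - Chebyshev.theta n ≤
        Real.log (n.factorial : ℝ) := by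
      rw [log_factorial_eq_sum_primesLE, mul_sum, Chebyshev.theta_eq_sum_primesLE_log,
        ← sum_sub_distrib]
      refine sum_le_sum fun p hp => ?_
      obtain ⟨hpn, hp⟩ := Nat.mem_primesLE.1 hp
      have hlog : 0 ≤ Real.log p := Real.log_natCast_nonneg p
      have h3 : n / p ≤ n.factorial.factorization p := by
        rw [Nat.factorization_factorial hp (Nat.lt_succ_self _)]
        have := single_le_sum (f := fun i => n / p ^ i) (s := Ico 1 (Nat.log p n).succ)
          (fun _ _ => Nat.zero_le _) (a := 1)
          (mem_Ico.2 ⟨le_rfl, by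
            have := Nat.log_pos hp.one_lt hpn
            omega⟩)
        simpa using this
      have h4 : (n : ℝ) / p - 1 ≤ n.factorial.factorization p := by
        have h5 := Nat.lt_floor_add_one ((n : ℝ) / p)
        rw [Nat.floor_div_eq_div] at h5
        have h6 : ((n / p : ℕ) : ℝ) ≤ n.factorial.factorization p := by exact_mod_cast h3
        linarith
      calc (n : ℝ) * (Real.log p / p) - Real.log p = (n / p - 1) * Real.log p := by ring
        _ ≤ _ := by gcongr
    have h3 := Chebyshev.theta_le_log4_mul_x hn'.le
    have h4 : Real.log 4 ≤ 2 := by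
      have := Real.log_two_lt_d9
      have h5 : Real.log 4 = 2 * Real.log 2 := by
        rw [show (4 : ℝ) = 2 ^ 2 by norm_num, Real.log_pow]; norm_num
      linarith
    have h5 : ∑ p ∈ Nat.primesLE n, Real.log p / (p : ℝ) ≤ Real.log n + 2 := by
      refine le_of_mul_le_mul_left ?_ hn'
      nlinarith
    linarith

/-- Abel summation against a function of bounded variation, comparing the weights `c n` with the
increments of the logarithm. -/
lemma sum_Ioc_mul_le_of_abs_sub_log_le {c : ℕ → ℝ} {C : ℝ}
    (hC : ∀ n : ℕ, 1 ≤ n → |∑ i ∈ Ioc 0 n, c i - Real.log n| ≤ C) (f : ℕ → ℝ) {a b : ℕ}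
    (ha : 1 ≤ a) (hab : a < b) :
    ∑ n ∈ Ioc a b, c n * f n ≤ ∑ n ∈ Ioc a b, (Real.log n - Real.log (n - 1 : ℕ)) * f n +
      C * (|f b| + |f (a + 1)| + ∑ n ∈ Ico (a + 1) b, |f n - f (n + 1)|) := by
  set E : ℕ → ℝ := fun n => ∑ i ∈ Ioc 0 n, c i - Real.log n with hE
  have hstep : ∀ n, 1 ≤ n → c n - (Real.log n - Real.log (n - 1 : ℕ)) = E n - E (n - 1) := by
    intro n hn
    obtain ⟨m, rfl⟩ : ∃ m, n = m + 1 := ⟨n - 1, by omega⟩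
    simp only [hE, add_tsub_cancel_right]
    rw [sum_Ioc_succ_top (Nat.zero_le _)]
    ring
  have hkey : ∑ n ∈ Ioc a b, (E n - E (n - 1)) * f n =
      E b * f b - E a * f (a + 1) + ∑ n ∈ Ico (a + 1) b, E n * (f n - f (n + 1)) := by
    clear_value E
    induction b, hab using Nat.le_induction with
    | base =>
      rw [Nat.succ_eq_add_one, sum_Ioc_succ_top le_rfl]
      simp
      ring
    | succ b hb ih =>
      rw [sum_Ioc_succ_top (by omega), ih, sum_Ico_succ_top (by omega)]
      simp only [add_tsub_cancel_right]
      ring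
  have hsum : ∑ n ∈ Ioc a b, c n * f n - ∑ n ∈ Ioc a b, (Real.log n - Real.log (n - 1 : ℕ)) * f n =
      ∑ n ∈ Ioc a b, (E n - E (n - 1)) * f n := by
    rw [← sum_sub_distrib]
    refine sum_congr rfl fun n hn => ?_
    rw [← hstep n (by have := (mem_Ioc.1 hn).1; omega)]
    ring
  have hb1 : ∀ n x, 1 ≤ n → E n * x ≤ C * |x| := fun n x hn =>
    (le_abs_self _).trans (by rw [abs_mul]; exact mul_le_mul_of_nonneg_right (hC n hn) (abs_nonneg _))
  have h1 := hb1 b (f b) (by omega)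
  have h2 := hb1 a (-f (a + 1)) ha
  rw [abs_neg] at h2
  have h3 : ∑ n ∈ Ico (a + 1) b, E n * (f n - f (n + 1)) ≤
      C * ∑ n ∈ Ico (a + 1) b, |f n - f (n + 1)| := by
    rw [mul_sum]
    exact sum_le_sum fun n hn => hb1 n _ (by have := (mem_Ico.1 hn).1; omega)
  nlinarith

lemma sum_Ioc_mul_le_of_antitoneOn {c : ℕ → ℝ} {C : ℝ}
    (hC : ∀ n : ℕ, 1 ≤ n → |∑ i ∈ Ioc 0 n, c i - Real.log n| ≤ C) (f : ℕ → ℝ) {a b : ℕ}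
    (ha : 1 ≤ a) (hab : a < b) (hf : AntitoneOn f (Set.Icc (a + 1) b)) (hfb : 0 ≤ f b) :
    ∑ n ∈ Ioc a b, c n * f n ≤ ∑ n ∈ Ioc a b, (Real.log n - Real.log (n - 1 : ℕ)) * f n +
      2 * C * f (a + 1) := by
  have h := sum_Ioc_mul_le_of_abs_sub_log_le hC f ha hab
  have h0 : f b ≤ f (a + 1) := hf ⟨le_rfl, hab⟩ ⟨hab, le_rfl⟩ hab
  have h1 : ∑ n ∈ Ico (a + 1) b, |f n - f (n + 1)| = f (a + 1) - f b := by
    have : ∀ n ∈ Ico (a + 1) b, |f n - f (n + 1)| = -(f (n + 1) - f n) := fun n hn => by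
      have hn := mem_Ico.1 hn
      rw [abs_of_nonneg, neg_sub]
      exact sub_nonneg.2 (hf ⟨hn.1, by omega⟩ ⟨by omega, by omega⟩ (by omega))
    rw [sum_congr rfl this, sum_neg_distrib, sum_Ico_sub _ hab]
    ring
  rw [h1, abs_of_nonneg hfb, abs_of_nonneg (hfb.trans h0)] at h
  linarith

lemma sum_Ioc_mul_le_of_monotoneOn {c : ℕ → ℝ} {C : ℝ}
    (hC : ∀ n : ℕ, 1 ≤ n → |∑ i ∈ Ioc 0 n, c i - Real.log n| ≤ C) (f : ℕ → ℝ) {a b : ℕ}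
    (ha : 1 ≤ a) (hab : a < b) (hf : MonotoneOn f (Set.Icc (a + 1) b)) (hfa : 0 ≤ f (a + 1)) :
    ∑ n ∈ Ioc a b, c n * f n ≤ ∑ n ∈ Ioc a b, (Real.log n - Real.log (n - 1 : ℕ)) * f n +
      2 * C * f b := by
  have h := sum_Ioc_mul_le_of_abs_sub_log_le hC f ha hab
  have h0 : f (a + 1) ≤ f b := hf ⟨le_rfl, hab⟩ ⟨hab, le_rfl⟩ hab
  have h1 : ∑ n ∈ Ico (a + 1) b, |f n - f (n + 1)| = f b - f (a + 1) := by
    have : ∀ n ∈ Ico (a + 1) b, |f n - f (n + 1)| = f (n + 1) - f n := fun n hn => by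
      have hn := mem_Ico.1 hn
      rw [abs_of_nonpos, neg_sub]
      exact sub_nonpos.2 (hf ⟨hn.1, by omega⟩ ⟨by omega, by omega⟩ (by omega))
    rw [sum_congr rfl this, sum_Ico_sub _ hab]
  rw [h1, abs_of_nonneg hfa, abs_of_nonneg (hfa.trans h0)] at h
  linarith

lemma log_div_antitoneOn_natCast {z : ℝ} (hz : 0 < z) {a b : ℕ} :
    AntitoneOn (fun n : ℕ => Real.log (z / n)) (Set.Icc (a + 1) b) := by
  intro m hm n hn hmn
  have hm0 : (0 : ℝ) < m := by exact_mod_cast (by have := hm.1; omega : 0 < m)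
  have hmn' : (m : ℝ) ≤ n := by exact_mod_cast hmn
  refine Real.log_le_log (div_pos hz (hm0.trans_le hmn')) ?_
  gcongr

lemma sum_mertensTerm_le :
    ∃ C : ℝ, 1 ≤ C ∧ ∀ z : ℝ, 1 ≤ z → ∑ n ∈ Ioc 1 ⌊z⌋₊, mertensTerm n ≤ Real.log z + C := by
  obtain ⟨C, hC1, hC⟩ := exists_abs_sum_mertensTerm_sub_log_le
  refine ⟨C, hC1, fun z hz => ?_⟩
  have hz1 : 1 ≤ ⌊z⌋₊ := Nat.le_floor (by simpa using hz)
  have h1 := (abs_le.1 (hC _ hz1)).2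
  have h2 : Real.log (⌊z⌋₊ : ℝ) ≤ Real.log z :=
    Real.log_le_log (by exact_mod_cast hz1) (Nat.floor_le (by linarith))
  have h3 : ∑ n ∈ Ioc 1 ⌊z⌋₊, mertensTerm n ≤ ∑ n ∈ Ioc 0 ⌊z⌋₊, mertensTerm n :=
    sum_le_sum_of_subset_of_nonneg (Ioc_subset_Ioc_left zero_le_one)
      fun n _ _ => mertensTerm_nonneg n
  linarith

lemma sum_mertensTerm_mul_log_div_le :
    ∃ C : ℝ, 1 ≤ C ∧ ∀ z : ℝ, 1 ≤ z →
      ∑ n ∈ Ioc 1 ⌊z⌋₊, mertensTerm n * Real.log (z / n) ≤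
        Real.log z ^ 2 / 2 + C * Real.log z := by
  obtain ⟨C, hC1, hC⟩ := exists_abs_sum_mertensTerm_sub_log_le
  refine ⟨2 * C, by linarith, fun z hz => ?_⟩
  have hlz : 0 ≤ Real.log z := Real.log_nonneg hz
  have hz0 : 0 < z := by linarith
  rcases Nat.lt_or_ge 1 ⌊z⌋₊ with hb | hb
  swap
  · rw [Ioc_eq_empty (by omega), sum_empty]
    positivity
  have hle : ∀ n : ℕ, 1 ≤ n → n ≤ ⌊z⌋₊ → 0 ≤ Real.log (z / n) := fun n hn1 hn => by
    have h0 : (0 : ℝ) < n := by exact_mod_cast hn1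
    exact Real.log_nonneg ((one_le_div h0).2 ((Nat.cast_le.2 hn).trans (Nat.floor_le hz0.le)))
  have h := sum_Ioc_mul_le_of_antitoneOn hC (fun n : ℕ => Real.log (z / n)) le_rfl hb
    (log_div_antitoneOn_natCast hz0) (hle _ hb.le le_rfl)
  have h1 : ∑ n ∈ Ioc 1 ⌊z⌋₊, (Real.log n - Real.log (n - 1 : ℕ)) * Real.log (z / n) ≤
      ∑ n ∈ Ioc 1 ⌊z⌋₊, (Real.log (z / (n - 1 : ℕ)) ^ 2 / 2 - Real.log (z / n) ^ 2 / 2) := by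
    refine sum_le_sum fun n hn => ?_
    have hn := (mem_Ioc.1 hn).1
    rw [Real.log_div hz0.ne' (by positivity), Real.log_div hz0.ne'
      (by have : n - 1 ≠ 0 := by omega
          exact_mod_cast this)]
    nlinarith [sq_nonneg (Real.log n - Real.log (n - 1 : ℕ))]
  have h2 : ∀ b : ℕ, 1 ≤ b →
      ∑ n ∈ Ioc 1 b, (Real.log (z / (n - 1 : ℕ)) ^ 2 / 2 - Real.log (z / n) ^ 2 / 2) =
      Real.log z ^ 2 / 2 - Real.log (z / b) ^ 2 / 2 := by
    intro b hb
    induction b, hb using Nat.le_induction with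
    | base => simp
    | succ b hb ih =>
      rw [sum_Ioc_succ_top (by omega), ih, Nat.add_sub_cancel]
      ring
  rw [h2 _ hb.le] at h1
  have h3 : Real.log (z / (1 + 1 : ℕ)) ≤ Real.log z :=
    Real.log_le_log (by positivity) (div_le_self hz0.le (by norm_num))
  have h4 : 2 * C * Real.log (z / (1 + 1 : ℕ)) ≤ 2 * C * Real.log z := by gcongr
  have h5 := sq_nonneg (Real.log (z / ⌊z⌋₊))
  linarith

lemma log_sub_log_pred_le {n : ℕ} (hn : 2 ≤ n) :
    Real.log n - Real.log (n - 1 : ℕ) ≤ Real.log 2 := by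
  have h1 : (0 : ℝ) < (n - 1 : ℕ) := by exact_mod_cast (by omega : 0 < n - 1)
  rw [← Real.log_div (by positivity) h1.ne']
  refine Real.log_le_log (by positivity) ?_
  rw [div_le_iff₀ h1]
  exact_mod_cast (by omega : n ≤ 2 * (n - 1))

lemma log_pred_le_log {n : ℕ} (hn : 2 ≤ n) : Real.log (n - 1 : ℕ) ≤ Real.log n := by
  refine Real.log_le_log (by exact_mod_cast (by omega : 0 < n - 1)) ?_
  exact_mod_cast (by omega : n - 1 ≤ n)

lemma sum_mertensTerm_mul_log_le :
    ∃ C : ℝ, 1 ≤ C ∧ ∀ z : ℝ, 1 ≤ z →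
      ∑ n ∈ Ioc 1 ⌊z⌋₊, mertensTerm n * Real.log n ≤
        Real.log z ^ 2 / 2 + C * Real.log z := by
  obtain ⟨C, hC1, hC⟩ := exists_abs_sum_mertensTerm_sub_log_le
  refine ⟨2 * C + 1, by linarith, fun z hz => ?_⟩
  have hlz : 0 ≤ Real.log z := Real.log_nonneg hz
  have hz0 : 0 < z := by linarith
  rcases Nat.lt_or_ge 1 ⌊z⌋₊ with hb | hb
  swap
  · rw [Ioc_eq_empty (by omega), sum_empty]
    positivity
  have hmono : MonotoneOn (fun n : ℕ => Real.log n) (Set.Icc (1 + 1) ⌊z⌋₊) := by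
    intro m hm n hn hmn
    have hm0 : (0 : ℝ) < m := by exact_mod_cast (by have := hm.1; omega : 0 < m)
    exact Real.log_le_log hm0 (by exact_mod_cast hmn)
  have h := sum_Ioc_mul_le_of_monotoneOn hC (fun n : ℕ => Real.log n) le_rfl hb hmono
    (Real.log_natCast_nonneg _)
  have h1 : ∑ n ∈ Ioc 1 ⌊z⌋₊, (Real.log n - Real.log (n - 1 : ℕ)) * Real.log n ≤
      ∑ n ∈ Ioc 1 ⌊z⌋₊, ((Real.log n ^ 2 / 2 + Real.log n) -
        (Real.log (n - 1 : ℕ) ^ 2 / 2 + Real.log (n - 1 : ℕ))) := by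
    refine sum_le_sum fun n hn => ?_
    have hn := (mem_Ioc.1 hn).1
    have h2 := log_sub_log_pred_le (n := n) (by omega)
    have h3 := log_pred_le_log (n := n) (by omega)
    have h4 := Real.log_two_lt_d9
    nlinarith
  have h2 : ∀ b : ℕ, 1 ≤ b →
      ∑ n ∈ Ioc 1 b, ((Real.log n ^ 2 / 2 + Real.log n) -
        (Real.log (n - 1 : ℕ) ^ 2 / 2 + Real.log (n - 1 : ℕ))) =
      Real.log b ^ 2 / 2 + Real.log b := by
    intro b hb
    induction b, hb using Nat.le_induction with
    | base => simp
    | succ b hb ih =>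
      rw [sum_Ioc_succ_top (by omega), ih, Nat.add_sub_cancel]
      ring
  rw [h2 _ hb.le] at h1
  have h3 : Real.log (⌊z⌋₊ : ℝ) ≤ Real.log z :=
    Real.log_le_log (by exact_mod_cast hb.le) (Nat.floor_le hz0.le)
  have h4 : 0 ≤ Real.log (⌊z⌋₊ : ℝ) := Real.log_natCast_nonneg _
  nlinarith

lemma one_sub_le_log_div {u v : ℝ} (hu : 0 < u) (hv : 0 < v) :
    1 - u / v ≤ Real.log v - Real.log u := by
  have h := Real.log_le_sub_one_of_pos (div_pos hu hv)
  rw [Real.log_div hu.ne' hv.ne'] at h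
  linarith

lemma sum_mertensTerm_mul_inv_log_sub_le :
    ∃ C : ℝ, 1 ≤ C ∧ ∀ z y : ℝ, 1 < z → z ≤ y →
      ∑ n ∈ Ioc ⌊z⌋₊ ⌊y⌋₊, mertensTerm n * (1 / Real.log n - 1 / Real.log y) ≤
        Real.log (Real.log y / Real.log z) - 1 + Real.log z / Real.log y + C / Real.log z := by
  obtain ⟨C, hC1, hC⟩ := exists_abs_sum_mertensTerm_sub_log_le
  refine ⟨2 * C + 1, by linarith, fun z y hz hzy => ?_⟩
  have hz0 : 0 < z := by linarith
  have hy0 : 0 < y := by linarith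
  have hlz : 0 < Real.log z := Real.log_pos hz
  have hlzy : Real.log z ≤ Real.log y := Real.log_le_log hz0 hzy
  have hly : 0 < Real.log y := hlz.trans_le hlzy
  have hRHS : 0 ≤ Real.log (Real.log y / Real.log z) - 1 + Real.log z / Real.log y := by
    have := one_sub_le_log_div hlz hly
    rw [Real.log_div hly.ne' hlz.ne']
    linarith
  rcases Nat.lt_or_ge ⌊z⌋₊ ⌊y⌋₊ with hb | hb
  swap
  · rw [Ioc_eq_empty (by omega), sum_empty]
    positivity
  have hz1 : 1 ≤ ⌊z⌋₊ := Nat.le_floor (by simpa using hz.le)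
  have hlogpos : ∀ n : ℕ, ⌊z⌋₊ + 1 ≤ n → Real.log z ≤ Real.log n := fun n hn => by
    refine Real.log_le_log hz0 ((Nat.lt_floor_add_one z).le.trans ?_)
    exact_mod_cast hn
  have hlogy : ∀ n : ℕ, 1 ≤ n → n ≤ ⌊y⌋₊ → Real.log n ≤ Real.log y := fun n hn1 hn => by
    refine Real.log_le_log (by exact_mod_cast hn1) ?_
    exact (Nat.cast_le.2 hn).trans (Nat.floor_le hy0.le)
  have hanti : AntitoneOn (fun n : ℕ => 1 / Real.log n - 1 / Real.log y)
      (Set.Icc (⌊z⌋₊ + 1) ⌊y⌋₊) := by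
    intro m hm n hn hmn
    have hm0 : (0 : ℝ) < m := by exact_mod_cast (by have := hm.1; omega : 0 < m)
    have h1 : Real.log m ≤ Real.log n := Real.log_le_log hm0 (by exact_mod_cast hmn)
    have h2 := hlogpos m hm.1
    have h3 : 1 / Real.log n ≤ 1 / Real.log m := one_div_le_one_div_of_le (by linarith) h1
    simpa using h3
  have hlast : 0 ≤ 1 / Real.log (⌊y⌋₊ : ℝ) - 1 / Real.log y := by
    have h1 := hlogpos ⌊y⌋₊ hb
    have h2 := hlogy ⌊y⌋₊ (by omega) le_rfl
    have := one_div_le_one_div_of_le (by linarith) h2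
    linarith
  have h := sum_Ioc_mul_le_of_antitoneOn hC
    (fun n : ℕ => 1 / Real.log n - 1 / Real.log y) hz1 hb hanti hlast
  have hfirst : 1 / Real.log (⌊z⌋₊ + 1 : ℕ) - 1 / Real.log y ≤ 1 / Real.log z := by
    have h1 := one_div_le_one_div_of_le hlz (hlogpos _ le_rfl)
    have h2 : 0 ≤ 1 / Real.log y := by positivity
    linarith
  have hkey : ∀ b : ℕ, ⌊z⌋₊ + 1 ≤ b →
      ∑ n ∈ Ioc ⌊z⌋₊ b, (Real.log n - Real.log (n - 1 : ℕ)) *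
        (1 / Real.log n - 1 / Real.log y) ≤
      1 / Real.log z + ((Real.log (Real.log b) - Real.log b / Real.log y) -
        (Real.log (Real.log (⌊z⌋₊ + 1 : ℕ)) - Real.log (⌊z⌋₊ + 1 : ℕ) / Real.log y)) := by
    intro b hb
    induction b, hb using Nat.le_induction with
    | base =>
      rw [sum_Ioc_succ_top le_rfl, Ioc_self, sum_empty, zero_add, sub_self, add_zero]
      have h1 := log_sub_log_pred_le (n := ⌊z⌋₊ + 1) (by omega)
      have h2 := log_pred_le_log (n := ⌊z⌋₊ + 1) (by omega)
      have h3 := Real.log_two_lt_d9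
      have h4 : 0 < 1 / Real.log z := by positivity
      nlinarith
    | succ b hb ih =>
      rw [sum_Ioc_succ_top (by omega), Nat.add_sub_cancel]
      have h1 : 0 < Real.log b := hlz.trans_le (hlogpos b hb)
      have h2 : 0 < Real.log (b + 1 : ℕ) := hlz.trans_le (hlogpos _ (by omega))
      have h3 := one_sub_le_log_div h1 h2
      have h4 : (Real.log (b + 1 : ℕ) - Real.log b) *
          (1 / Real.log (b + 1 : ℕ) - 1 / Real.log y) =
          (1 - Real.log b / Real.log (b + 1 : ℕ)) -
            (Real.log (b + 1 : ℕ) / Real.log y - Real.log b / Real.log y) := by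
        field_simp
      rw [h4]
      linarith
  have hk := hkey _ hb
  have hmono : ∀ u v : ℝ, 0 < u → u ≤ v → v ≤ Real.log y →
      Real.log u - u / Real.log y ≤ Real.log v - v / Real.log y := by
    intro u v hu huv hv
    have hv0 := hu.trans_le huv
    have h1 := one_sub_le_log_div hu hv0
    have h2 : 1 - u / v = (v - u) / v := by field_simp
    have h3 : (v - u) / Real.log y ≤ (v - u) / v :=
      div_le_div_of_nonneg_left (by linarith) hv0 hv
    rw [sub_div] at h3
    linarith
  have h1 := hmono _ _ (hlz.trans_le (hlogpos ⌊y⌋₊ hb)) (hlogy ⌊y⌋₊ (by omega) le_rfl) le_rfl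
  have h2 := hmono _ _ hlz (hlogpos (⌊z⌋₊ + 1) le_rfl) (hlogy _ (by omega) hb)
  have h3 : 2 * C * (1 / Real.log (⌊z⌋₊ + 1 : ℕ) - 1 / Real.log y) ≤
      2 * C * (1 / Real.log z) := by gcongr
  rw [Real.log_div hly.ne' hlz.ne']
  rw [div_self hly.ne'] at h1
  have h4 : (2 * C + 1) / Real.log z = 2 * C * (1 / Real.log z) + 1 / Real.log z := by ring
  rw [h4]
  linarith

/-- The upper bound in Mertens' second theorem. -/
lemma sum_inv_prime_le :
    ∃ C : ℝ, 1 ≤ C ∧ ∀ y : ℝ, 3 ≤ y →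
      ∑ p ∈ (Ioc 1 ⌊y⌋₊).filter Nat.Prime, 1 / (p : ℝ) ≤ Real.log (Real.log y) + C := by
  obtain ⟨C, hC1, hC⟩ := sum_mertensTerm_mul_inv_log_sub_le
  obtain ⟨C', hC'1, hC'⟩ := sum_mertensTerm_le
  refine ⟨C + C' + 2, by linarith, fun y hy => ?_⟩
  have he : Real.exp 1 ≤ y := by linarith [Real.exp_one_lt_d9]
  have hfl : ⌊Real.exp 1⌋₊ = 2 := by
    rw [Nat.floor_eq_iff (by positivity)]
    constructor <;> norm_num <;> linarith [Real.exp_one_lt_d9, Real.exp_one_gt_d9]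
  have h := hC (Real.exp 1) y (by linarith [Real.exp_one_gt_d9]) he
  have hly : 1 ≤ Real.log y := by
    rw [Real.le_log_iff_exp_le (by linarith)]
    exact he
  rw [hfl, Real.log_exp, div_one, div_one] at h
  have h2 := hC' y (by linarith)
  have hy2 : 2 ≤ ⌊y⌋₊ := Nat.le_floor (by norm_num; linarith)
  have h3 : ∑ p ∈ (Ioc 1 ⌊y⌋₊).filter Nat.Prime, 1 / (p : ℝ) =
      1 / 2 + ∑ n ∈ Ioc 2 ⌊y⌋₊, mertensTerm n * (1 / Real.log n) := by
    have hIoc : Ioc 1 ⌊y⌋₊ = insert 2 (Ioc 2 ⌊y⌋₊) := by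
      ext n
      simp only [mem_Ioc, mem_insert]
      omega
    rw [sum_filter, hIoc, sum_insert (by simp), if_pos Nat.prime_two]
    congr 1
    refine sum_congr rfl fun n hn => ?_
    unfold mertensTerm
    split_ifs with hp
    · have : 0 < Real.log n := Real.log_pos (by exact_mod_cast hp.one_lt)
      field_simp
    · simp
  have h4 : ∑ n ∈ Ioc 2 ⌊y⌋₊, mertensTerm n * (1 / Real.log n - 1 / Real.log y) =
      ∑ n ∈ Ioc 2 ⌊y⌋₊, mertensTerm n * (1 / Real.log n) -
        (∑ n ∈ Ioc 2 ⌊y⌋₊, mertensTerm n) / Real.log y := by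
    rw [sum_div, ← sum_sub_distrib]
    exact sum_congr rfl fun n _ => by ring
  have h5 : ∑ n ∈ Ioc 2 ⌊y⌋₊, mertensTerm n ≤ ∑ n ∈ Ioc 1 ⌊y⌋₊, mertensTerm n :=
    sum_le_sum_of_subset_of_nonneg (Ioc_subset_Ioc_left one_le_two)
      fun n _ _ => mertensTerm_nonneg n
  have h6 : (∑ n ∈ Ioc 2 ⌊y⌋₊, mertensTerm n) / Real.log y ≤ 1 + C' := by
    rw [div_le_iff₀ (by linarith)]
    nlinarith
  have h7 : 1 / Real.log y ≤ 1 := by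
    rw [div_le_one (by linarith)]
    exact hly
  rw [h3]
  linarith

/-- The multiplicative extension of `f` to squarefree numbers. -/
noncomputable def primeProd (f : ℕ → ℝ) (n : ℕ) : ℝ := ∏ p ∈ n.primeFactors, f p

@[simp] lemma primeProd_one (f : ℕ → ℝ) : primeProd f 1 = 1 := by simp [primeProd]

lemma primeProd_prime (f : ℕ → ℝ) {p : ℕ} (hp : p.Prime) : primeProd f p = f p := by
  simp [primeProd, hp.primeFactors]

lemma primeProd_mul (f : ℕ → ℝ) {m n : ℕ} (h : m.Coprime n) :
    primeProd f (m * n) = primeProd f m * primeProd f n := by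
  rw [primeProd, h.primeFactors_mul, prod_union h.disjoint_primeFactors]
  rfl

lemma primeFactors_lcm_eq_union {m n : ℕ} (hm : m ≠ 0) (hn : n ≠ 0) :
    (m.lcm n).primeFactors = m.primeFactors ∪ n.primeFactors := by
  ext p
  simp only [Nat.mem_primeFactors, mem_union]
  constructor
  · rintro ⟨hp, hd, -⟩
    rcases (hp.dvd_lcm).1 hd with h | h
    · exact Or.inl ⟨hp, h, hm⟩
    · exact Or.inr ⟨hp, h, hn⟩
  · rintro (⟨hp, hd, -⟩ | ⟨hp, hd, -⟩)
    · exact ⟨hp, hd.trans (Nat.dvd_lcm_left _ _), Nat.lcm_ne_zero hm hn⟩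
    · exact ⟨hp, hd.trans (Nat.dvd_lcm_right _ _), Nat.lcm_ne_zero hm hn⟩

lemma primeProd_lcm_mul_gcd (f : ℕ → ℝ) {m n : ℕ} (hm : m ≠ 0) (hn : n ≠ 0) :
    primeProd f (m.lcm n) * primeProd f (m.gcd n) = primeProd f m * primeProd f n := by
  rw [primeProd, primeProd, primeFactors_lcm_eq_union hm hn, Nat.primeFactors_gcd hm hn,
    prod_union_inter]
  rfl

lemma primeProd_one_add (f : ℕ → ℝ) {n : ℕ} (hn : Squarefree n) :
    primeProd (fun p => 1 + f p) n = ∑ d ∈ n.divisors, primeProd f d := by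
  have h := (IsMultiplicative.prodPrimeFactors f).prodPrimeFactors_one_add_of_squarefree hn
  have h1 : ∀ d : ℕ, d ≠ 0 → prodPrimeFactors f d = primeProd f d := fun d hd =>
    prodPrimeFactors_apply hd
  have h2 : primeProd (fun p => 1 + f p) n =
      ∏ p ∈ n.primeFactors, (1 + prodPrimeFactors f p) :=
    prod_congr rfl fun p hp => by
      have hp := Nat.prime_of_mem_primeFactors hp
      rw [h1 p hp.ne_zero, primeProd_prime f hp]
  rw [h2, h]
  exact sum_congr rfl fun d hd => h1 d (Nat.pos_of_mem_divisors hd).ne'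

/-- The density of the residue classes modulo a squarefree number in which seven linear forms
have a product divisible by it. -/
noncomputable def sieveDensity : ℕ → ℝ := primeProd fun p => 7 / p

/-- The weights diagonalising Selberg's quadratic form for `sieveDensity`. -/
noncomputable def sieveWeight : ℕ → ℝ := primeProd fun p => 7 / ((p : ℝ) - 7)

lemma primeProd_pos {f : ℕ → ℝ} {n : ℕ} (h : ∀ p, p.Prime → p ∣ n → 0 < f p) :
    0 < primeProd f n :=
  prod_pos fun p hp => h p (Nat.prime_of_mem_primeFactors hp) (Nat.dvd_of_mem_primeFactors hp)

lemma sieveDensity_pos (n : ℕ) : 0 < sieveDensity n :=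
  primeProd_pos fun p hp _ => by
    have := hp.pos
    positivity

lemma sieveWeight_pos {n : ℕ} (hn : ∀ p : ℕ, p.Prime → p ∣ n → 7 < p) : 0 < sieveWeight n :=
  primeProd_pos fun p hp hpn => by
    have h : (7 : ℝ) < p := by exact_mod_cast hn p hp hpn
    have : 0 < (p : ℝ) - 7 := by linarith
    positivity

lemma inv_sieveDensity {n : ℕ} (hn : Squarefree n) (hn7 : ∀ p : ℕ, p.Prime → p ∣ n → 7 < p) :
    (sieveDensity n)⁻¹ = ∑ d ∈ n.divisors, (sieveWeight d)⁻¹ := by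
  have h := primeProd_one_add (fun p => (7 / ((p : ℝ) - 7))⁻¹) hn
  have h1 : (sieveDensity n)⁻¹ = primeProd (fun p => 1 + (7 / ((p : ℝ) - 7))⁻¹) n := by
    unfold sieveDensity primeProd
    rw [← prod_inv_distrib]
    refine prod_congr rfl fun p hp => ?_
    have h : (7 : ℝ) < p := by
      exact_mod_cast hn7 p (Nat.prime_of_mem_primeFactors hp) (Nat.dvd_of_mem_primeFactors hp)
    have : (p : ℝ) - 7 ≠ 0 := by linarith
    field_simp
    ring
  rw [h1, h]
  refine sum_congr rfl fun d _ => ?_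
  unfold sieveWeight primeProd
  rw [prod_inv_distrib]

lemma sum_divisors_moebius (n : ℕ) :
    ∑ d ∈ n.divisors, (moebius d : ℝ) = if n = 1 then 1 else 0 := by
  have h := congrArg (fun f : ArithmeticFunction ℝ => f n)
    (coe_moebius_mul_coe_zeta (R := ℝ))
  simp only [coe_mul_zeta_apply, one_apply] at h
  simpa using h

/-- Squarefree numbers all of whose prime factors are at least `14`, closed under divisors. -/
structure IsSieveSupport (S : Finset ℕ) : Prop where
  squarefree : ∀ r ∈ S, Squarefree r
  large : ∀ r ∈ S, ∀ p : ℕ, p.Prime → p ∣ r → 14 ≤ p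
  closed : ∀ r ∈ S, ∀ d, d ∣ r → d ∈ S

namespace IsSieveSupport

variable {S : Finset ℕ}

lemma ne_zero (hS : IsSieveSupport S) {r : ℕ} (hr : r ∈ S) : r ≠ 0 := (hS.squarefree r hr).ne_zero

lemma filter_not_dvd (hS : IsSieveSupport S) (p : ℕ) :
    IsSieveSupport (S.filter fun r => ¬ p ∣ r) where
  squarefree r hr := hS.squarefree r (mem_filter.1 hr).1
  large r hr := hS.large r (mem_filter.1 hr).1
  closed r hr d hd := mem_filter.2 ⟨hS.closed r (mem_filter.1 hr).1 d hd,
    fun h => (mem_filter.1 hr).2 (h.trans hd)⟩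

end IsSieveSupport

/-- The Selberg coefficients attached to the diagonal variables `y`. -/
noncomputable def selbergCoeff (S : Finset ℕ) (y : ℕ → ℝ) (d : ℕ) : ℝ :=
  moebius d * (sieveDensity d)⁻¹ * ∑ m ∈ S with d ∣ m, sieveWeight m * y m

namespace IsSieveSupport

variable {S : Finset ℕ}

lemma weight_pos (hS : IsSieveSupport S) {r : ℕ} (hr : r ∈ S) : 0 < sieveWeight r :=
  sieveWeight_pos fun p hp hpr => by have := hS.large r hr p hp hpr; omega

lemma sum_moebius_between (hS : IsSieveSupport S) {r m : ℕ} (hr : r ∣ m) (hm : m ∈ S) :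
    ∑ d ∈ S with r ∣ d ∧ d ∣ m, (moebius d : ℝ) = if m = r then (moebius r : ℝ) else 0 := by
  obtain ⟨k, rfl⟩ := hr
  have hm0 := hS.ne_zero hm
  have hr0 : r ≠ 0 := left_ne_zero_of_mul hm0
  have hk0 : k ≠ 0 := right_ne_zero_of_mul hm0
  have h1 : (S.filter fun d => r ∣ d ∧ d ∣ r * k) = k.divisors.image (r * ·) := by
    ext d
    simp only [mem_filter, mem_image, Nat.mem_divisors]
    constructor
    · rintro ⟨-, ⟨e, rfl⟩, he⟩
      exact ⟨e, ⟨Nat.dvd_of_mul_dvd_mul_left (Nat.pos_of_ne_zero hr0) he, hk0⟩, rfl⟩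
    · rintro ⟨e, ⟨he, -⟩, rfl⟩
      have := Nat.mul_dvd_mul_left r he
      exact ⟨hS.closed _ hm _ this, dvd_mul_right _ _, this⟩
  rw [h1, sum_image fun a _ b _ h => Nat.eq_of_mul_eq_mul_left (Nat.pos_of_ne_zero hr0) h]
  have h2 : ∀ e ∈ k.divisors, (moebius (r * e) : ℝ) = moebius r * moebius e := fun e he => by
    have hc : r.Coprime e := by
      have := Nat.coprime_of_squarefree_mul (hS.squarefree _ hm)
      exact this.coprime_dvd_right (Nat.dvd_of_mem_divisors he)
    rw [isMultiplicative_moebius.map_mul_of_coprime hc]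
    push_cast
    rfl
  rw [sum_congr rfl h2, ← mul_sum, sum_divisors_moebius]
  by_cases hk : k = 1
  · simp [hk]
  · rw [if_neg hk, if_neg, mul_zero]
    exact fun h => hk (Nat.eq_of_mul_eq_mul_left (Nat.pos_of_ne_zero hr0) (by simpa using h))

lemma sum_selbergCoeff_mul_density (hS : IsSieveSupport S) (y : ℕ → ℝ) {r : ℕ} (hr : r ∈ S) :
    ∑ d ∈ S with r ∣ d, selbergCoeff S y d * sieveDensity d =
      moebius r * sieveWeight r * y r := by
  have h1 : ∀ d, selbergCoeff S y d * sieveDensity d =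
      ∑ m ∈ S with d ∣ m, sieveWeight m * y m * moebius d := fun d => by
    have := (sieveDensity_pos d).ne'
    rw [selbergCoeff, ← sum_mul]
    field_simp
  rw [sum_congr rfl fun d _ => h1 d,
    sum_comm' (t' := S.filter (r ∣ ·)) (s' := fun m => S.filter fun d => r ∣ d ∧ d ∣ m)]
  · have h2 : ∀ m ∈ S.filter (r ∣ ·),
        ∑ d ∈ S with r ∣ d ∧ d ∣ m, sieveWeight m * y m * (moebius d : ℝ) =
        if m = r then moebius r * sieveWeight r * y r else 0 := fun m hm => by
      rw [← mul_sum, hS.sum_moebius_between (mem_filter.1 hm).2 (mem_filter.1 hm).1]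
      split_ifs with h
      · rw [h]; ring
      · simp
    rw [sum_congr rfl h2, sum_ite_eq' , if_pos (mem_filter.2 ⟨hr, dvd_rfl⟩)]
  · intro d m
    simp only [mem_filter]
    constructor
    · rintro ⟨⟨hd, hrd⟩, hm, hdm⟩
      exact ⟨⟨hd, hrd, hdm⟩, hm, hrd.trans hdm⟩
    · rintro ⟨⟨hd, hrd, hdm⟩, hm, -⟩
      exact ⟨⟨hd, hrd⟩, hm, hdm⟩

/-- Selberg's quadratic form is diagonal in the variables `y`. -/
theorem sum_selbergCoeff_mul_selbergCoeff (hS : IsSieveSupport S) (y : ℕ → ℝ) :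
    ∑ d ∈ S, ∑ e ∈ S, selbergCoeff S y d * selbergCoeff S y e * sieveDensity (d.lcm e) =
      ∑ r ∈ S, sieveWeight r * y r ^ 2 := by
  set u : ℕ → ℝ := fun d => selbergCoeff S y d * sieveDensity d with hu
  have h1 : ∀ d ∈ S, ∀ e ∈ S,
      selbergCoeff S y d * selbergCoeff S y e * sieveDensity (d.lcm e) =
      ∑ r ∈ S, if r ∣ d ∧ r ∣ e then (sieveWeight r)⁻¹ * (u d * u e) else 0 := by
    intro d hd e he
    have hg := primeProd_lcm_mul_gcd (fun p => 7 / (p : ℝ)) (hS.ne_zero hd) (hS.ne_zero he)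
    have hpos := sieveDensity_pos (d.gcd e)
    have hgS : d.gcd e ∈ S := hS.closed d hd _ (Nat.gcd_dvd_left _ _)
    have h2 : sieveDensity (d.lcm e) =
        sieveDensity d * sieveDensity e * (sieveDensity (d.gcd e))⁻¹ := by
      rw [eq_mul_inv_iff_mul_eq₀ hpos.ne']
      exact hg
    have h3 : S.filter (fun r => r ∣ d ∧ r ∣ e) = (d.gcd e).divisors := by
      ext r
      simp only [mem_filter, Nat.mem_divisors, Nat.dvd_gcd_iff]
      exact ⟨fun h => ⟨h.2, hS.ne_zero hgS⟩, fun h => ⟨hS.closed d hd r h.1.1, h.1⟩⟩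
    rw [← sum_filter, h3, ← sum_mul, ← inv_sieveDensity (hS.squarefree _ hgS) (fun p hp hpg => by
      have := hS.large _ hgS p hp hpg; omega), h2]
    simp only [hu]
    ring
  rw [sum_congr rfl fun d hd => sum_congr rfl fun e he => h1 d hd e he]
  rw [sum_congr rfl fun d _ => sum_comm, sum_comm]
  refine sum_congr rfl fun r hr => ?_
  have h4 : ∑ d ∈ S, ∑ e ∈ S, (if r ∣ d ∧ r ∣ e then (sieveWeight r)⁻¹ * (u d * u e) else 0) =
      (sieveWeight r)⁻¹ * (∑ d ∈ S with r ∣ d, u d) ^ 2 := by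
    rw [sq, sum_mul_sum, mul_sum, sum_filter]
    refine sum_congr rfl fun d _ => ?_
    split_ifs with hd
    · rw [mul_sum, sum_filter]
      exact sum_congr rfl fun e _ => by simp [hd]
    · exact sum_eq_zero fun e _ => by simp [hd]
  rw [h4, hS.sum_selbergCoeff_mul_density y hr]
  have hm : (moebius r : ℝ) ^ 2 = 1 := by
    exact_mod_cast moebius_sq_eq_one_of_squarefree (hS.squarefree r hr)
  have hw := (hS.weight_pos hr).ne'
  rw [mul_pow, mul_pow, hm]
  field_simp

/-- Merging the coefficients of `d` and `p * d` yields Selberg coefficients again. -/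
lemma selbergCoeff_add_selbergCoeff_mul (hS : IsSieveSupport S) (y : ℕ → ℝ) {p : ℕ}
    (hp : p.Prime) (hp7 : 7 < p) (hy : ∀ m ∈ S, ¬ p ∣ m → p * m ∉ S → y (p * m) = 0)
    {d : ℕ} (hpd : ¬ p ∣ d) :
    selbergCoeff S y d + selbergCoeff S y (p * d) =
      selbergCoeff (S.filter fun r => ¬ p ∣ r) (fun m => y m - y (p * m)) d := by
  have hp0 : (p : ℝ) ≠ 0 := by exact_mod_cast hp.ne_zero
  have hp7' : (p : ℝ) - 7 ≠ 0 := by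
    have : (7 : ℝ) < p := by exact_mod_cast hp7
    linarith
  have hc : p.Coprime d := (hp.coprime_iff_not_dvd).2 hpd
  have hg : sieveDensity (p * d) = 7 / p * sieveDensity d := by
    rw [sieveDensity, primeProd_mul _ hc, primeProd_prime _ hp]
  have hmu : (moebius (p * d) : ℝ) = -moebius d := by
    rw [isMultiplicative_moebius.map_mul_of_coprime hc, moebius_apply_prime hp]
    push_cast
    ring
  set A : ℝ := ∑ m ∈ S with ¬ p ∣ m ∧ d ∣ m, sieveWeight m * y m with hA
  set B : ℝ := ∑ m ∈ S with ¬ p ∣ m ∧ d ∣ m, sieveWeight m * y (p * m) with hB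
  have h1 : ∑ m ∈ S with p * d ∣ m, sieveWeight m * y m = 7 / ((p : ℝ) - 7) * B := by
    have h2 : S.filter (fun m => p * d ∣ m) =
        (S.filter fun m => (¬ p ∣ m ∧ d ∣ m) ∧ p * m ∈ S).image (p * ·) := by
      ext m
      simp only [mem_filter, mem_image]
      constructor
      · rintro ⟨hm, k, rfl⟩
        rw [mul_assoc] at hm ⊢
        refine ⟨d * k, ⟨hS.closed _ hm _ (dvd_mul_left _ _), ⟨fun h => ?_, dvd_mul_right _ _⟩, hm⟩, rfl⟩
        have hsq := hS.squarefree _ hm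
        exact hp.one_lt.ne' (Nat.isUnit_iff.1 (hsq p (Nat.mul_dvd_mul_left p h)))
      · rintro ⟨m, ⟨-, ⟨-, hd⟩, hm⟩, rfl⟩
        exact ⟨hm, Nat.mul_dvd_mul_left p hd⟩
    rw [h2, sum_image fun a _ b _ h => Nat.eq_of_mul_eq_mul_left hp.pos h, hB, mul_sum,
      ← filter_filter, sum_filter]
    refine sum_congr rfl fun m hm => ?_
    have hm := mem_filter.1 hm
    split_ifs with h
    · rw [sieveWeight, primeProd_mul _ ((hp.coprime_iff_not_dvd).2 hm.2.1), primeProd_prime _ hp]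
      ring
    · rw [hy m hm.1 hm.2.1 h]
      ring
  have h2 : ∑ m ∈ S with d ∣ m, sieveWeight m * y m = A + 7 / ((p : ℝ) - 7) * B := by
    rw [← h1, hA, ← sum_filter_add_sum_filter_not (S.filter (d ∣ ·)) (fun m => ¬ p ∣ m),
      filter_filter, filter_filter]
    congr 2
    · exact filter_congr fun m _ => and_comm
    · refine filter_congr fun m _ => ?_
      rw [not_not]
      exact ⟨fun h => hc.mul_dvd_of_dvd_of_dvd h.2 h.1,
        fun h => ⟨(dvd_mul_left _ _).trans h, (dvd_mul_right _ _).trans h⟩⟩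
  have h3 : ∑ m ∈ (S.filter fun r => ¬ p ∣ r) with d ∣ m, sieveWeight m * (y m - y (p * m)) =
      A - B := by
    rw [hA, hB, ← sum_sub_distrib, filter_filter]
    exact sum_congr rfl fun m _ => by ring
  have hgd := (sieveDensity_pos d).ne'
  rw [selbergCoeff, selbergCoeff, selbergCoeff, h1, h2, h3, hg, hmu]
  field_simp
  ring

lemma selbergCoeff_eq_zero (hS : IsSieveSupport S) (y : ℕ → ℝ) {d : ℕ} (hd : d ∉ S) :
    selbergCoeff S y d = 0 := by
  rw [selbergCoeff, filter_false_of_mem fun m hm h => hd (hS.closed m hm d h)]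
  simp

/-- On multiples of `p` the Selberg sum only involves the merged coefficients. -/
lemma sum_selbergCoeff_of_dvd (hS : IsSieveSupport S) (y : ℕ → ℝ) {p : ℕ}
    (hp : p.Prime) (hp7 : 7 < p) (hy : ∀ m ∈ S, ¬ p ∣ m → p * m ∉ S → y (p * m) = 0)
    {N : ℕ} (hN : p ∣ N) :
    ∑ d ∈ S with d ∣ N, selbergCoeff S y d =
      ∑ d ∈ (S.filter fun r => ¬ p ∣ r) with d ∣ N,
        selbergCoeff (S.filter fun r => ¬ p ∣ r) (fun m => y m - y (p * m)) d := by
  have h0 : ∀ d ∈ (S.filter fun r => ¬ p ∣ r).filter (· ∣ N), ¬ p ∣ d := fun d hd =>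
    (mem_filter.1 (mem_filter.1 hd).1).2
  rw [← sum_congr rfl fun d hd => hS.selbergCoeff_add_selbergCoeff_mul y hp hp7 hy (h0 d hd),
    sum_add_distrib, ← sum_filter_add_sum_filter_not (S.filter (· ∣ N)) (fun m => ¬ p ∣ m)]
  congr 1
  · rw [filter_comm]
  · have h1 : (S.filter (· ∣ N)).filter (fun m => ¬ ¬ p ∣ m) =
        (((S.filter fun r => ¬ p ∣ r).filter (· ∣ N)).filter (fun m => p * m ∈ S)).image
          (p * ·) := by
      ext m
      simp only [mem_filter, mem_image, not_not]
      constructor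
      · rintro ⟨⟨hm, hmN⟩, k, rfl⟩
        refine ⟨k, ⟨⟨⟨hS.closed _ hm _ (dvd_mul_left _ _), fun h => ?_⟩,
          (dvd_mul_left _ _).trans hmN⟩, hm⟩, rfl⟩
        exact hp.one_lt.ne' (Nat.isUnit_iff.1 (hS.squarefree _ hm p (Nat.mul_dvd_mul_left p h)))
      · rintro ⟨m, ⟨⟨⟨-, hpm⟩, hmN⟩, hm⟩, rfl⟩
        exact ⟨⟨hm, ((hp.coprime_iff_not_dvd).2 hpm).mul_dvd_of_dvd_of_dvd hN hmN⟩,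
          dvd_mul_right _ _⟩
    rw [h1, sum_image fun a _ b _ h => Nat.eq_of_mul_eq_mul_left hp.pos h, sum_filter]
    refine sum_congr rfl fun m _ => ?_
    split_ifs with h
    · rfl
    · exact (hS.selbergCoeff_eq_zero y h).symm

lemma weight_le_two_pow_mul (hS : IsSieveSupport S) {d : ℕ} (hd : d ∈ S) :
    sieveWeight d ≤ 2 ^ d.primeFactors.card * sieveDensity d := by
  rw [sieveWeight, sieveDensity, primeProd, primeProd, ← prod_const, ← prod_mul_distrib]
  have h14 : ∀ p ∈ d.primeFactors, (14 : ℝ) ≤ p := fun p hp => by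
    exact_mod_cast hS.large d hd p (Nat.prime_of_mem_primeFactors hp)
      (Nat.dvd_of_mem_primeFactors hp)
  refine prod_le_prod (fun p hp => ?_) fun p hp => ?_
  · have := h14 p hp
    have : 0 < (p : ℝ) - 7 := by linarith
    positivity
  · have := h14 p hp
    rw [mul_div, div_le_div_iff₀ (by linarith) (by linarith)]
    linarith

lemma abs_selbergCoeff_le (hS : IsSieveSupport S) {y : ℕ → ℝ} {B : ℝ}
    (hy : ∀ m ∈ S, 0 ≤ y m) (hyB : ∀ m ∈ S, y m ≤ B) {d : ℕ} (hd : d ∈ S) :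
    |selbergCoeff S y d| ≤ 2 ^ d.primeFactors.card * (B * ∑ m ∈ S, sieveWeight m) := by
  have hB : 0 ≤ B := (hy d hd).trans (hyB d hd)
  have hg := sieveDensity_pos d
  have hmu : |(moebius d : ℝ)| ≤ 1 := by exact_mod_cast abs_moebius_le_one
  have h0 : 0 ≤ ∑ m ∈ S with d ∣ m, sieveWeight m * y m := sum_nonneg fun m hm =>
    mul_nonneg (hS.weight_pos (mem_filter.1 hm).1).le (hy m (mem_filter.1 hm).1)
  have hd0 : 0 < d := Nat.pos_of_ne_zero (hS.ne_zero hd)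
  have h1 : ∑ m ∈ S with d ∣ m, sieveWeight m * y m ≤
      sieveWeight d * (B * ∑ m ∈ S, sieveWeight m) := by
    have h2 : S.filter (d ∣ ·) = (S.filter fun k => d * k ∈ S).image (d * ·) := by
      ext m
      simp only [mem_filter, mem_image]
      constructor
      · rintro ⟨hm, k, rfl⟩
        exact ⟨k, ⟨hS.closed _ hm _ (dvd_mul_left _ _), hm⟩, rfl⟩
      · rintro ⟨k, ⟨-, hk⟩, rfl⟩
        exact ⟨hk, dvd_mul_right _ _⟩
    rw [h2, sum_image fun a _ b _ h => Nat.eq_of_mul_eq_mul_left hd0 h, mul_sum, mul_sum]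
    refine (sum_le_sum fun k hk => ?_).trans (sum_le_sum_of_subset_of_nonneg
      (filter_subset _ _) fun k hk _ => ?_)
    · have hk := mem_filter.1 hk
      have hc := Nat.coprime_of_squarefree_mul (hS.squarefree _ hk.2)
      have h3 : sieveWeight (d * k) = sieveWeight d * sieveWeight k := primeProd_mul _ hc
      have h4 := hS.weight_pos hd
      have h5 := hS.weight_pos hk.1
      calc sieveWeight (d * k) * y (d * k) ≤ sieveWeight (d * k) * B := by
            rw [h3]
            exact mul_le_mul_of_nonneg_left (hyB _ hk.2) (by positivity)
        _ = _ := by rw [h3]; ring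
    · have h4 := hS.weight_pos hd
      have h5 := hS.weight_pos hk
      positivity
  have hH : 0 ≤ B * ∑ m ∈ S, sieveWeight m :=
    mul_nonneg hB (sum_nonneg fun m hm => (hS.weight_pos hm).le)
  rw [selbergCoeff, abs_mul, abs_mul, abs_of_nonneg h0, abs_of_pos (inv_pos.2 hg)]
  calc |(moebius d : ℝ)| * (sieveDensity d)⁻¹ * ∑ m ∈ S with d ∣ m, sieveWeight m * y m
      ≤ 1 * (sieveDensity d)⁻¹ * (sieveWeight d * (B * ∑ m ∈ S, sieveWeight m)) := by gcongr
    _ ≤ 1 * (sieveDensity d)⁻¹ * ((2 ^ d.primeFactors.card * sieveDensity d) *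
        (B * ∑ m ∈ S, sieveWeight m)) := by
      gcongr
      exact hS.weight_le_two_pow_mul hd
    _ = _ := by field_simp

/-- The mean value of the square of a Selberg sum. -/
theorem abs_sum_sq_sub_le (hS : IsSieveSupport S) {y : ℕ → ℝ} {B : ℝ}
    (hy : ∀ m ∈ S, 0 ≤ y m) (hyB : ∀ m ∈ S, y m ≤ B) (I : Finset ℕ) (F : ℕ → ℕ) {X E : ℝ}
    (hcount : ∀ d ∈ S, ∀ e ∈ S,
      |((I.filter fun t => d ∣ F t ∧ e ∣ F t).card : ℝ) - X * sieveDensity (d.lcm e)| ≤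
        E * (7 ^ d.primeFactors.card * 7 ^ e.primeFactors.card)) :
    |∑ t ∈ I, (∑ d ∈ S with d ∣ F t, selbergCoeff S y d) ^ 2 -
        X * ∑ m ∈ S, sieveWeight m * y m ^ 2| ≤
      E * ((B * ∑ m ∈ S, sieveWeight m) * ∑ d ∈ S, 14 ^ d.primeFactors.card) ^ 2 := by
  have h1 : ∑ t ∈ I, (∑ d ∈ S with d ∣ F t, selbergCoeff S y d) ^ 2 =
      ∑ d ∈ S, ∑ e ∈ S, selbergCoeff S y d * selbergCoeff S y e *
        ((I.filter fun t => d ∣ F t ∧ e ∣ F t).card : ℝ) := by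
    have h2 : ∀ t, (∑ d ∈ S with d ∣ F t, selbergCoeff S y d) ^ 2 =
        ∑ d ∈ S, ∑ e ∈ S, selbergCoeff S y d * selbergCoeff S y e *
          (if d ∣ F t ∧ e ∣ F t then 1 else 0) := fun t => by
      rw [sq, sum_mul_sum, sum_filter]
      refine sum_congr rfl fun d _ => ?_
      split_ifs with hd
      · rw [sum_filter]
        exact sum_congr rfl fun e _ => by simp [hd]
      · exact (sum_eq_zero fun e _ => by simp [hd]).symm
    rw [sum_congr rfl fun t _ => h2 t, sum_comm]
    refine sum_congr rfl fun d _ => ?_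
    rw [sum_comm]
    refine sum_congr rfl fun e _ => ?_
    rw [← mul_sum, sum_boole]
  rw [h1, ← hS.sum_selbergCoeff_mul_selbergCoeff y, mul_sum, ← sum_sub_distrib]
  have h3 : E * ((B * ∑ m ∈ S, sieveWeight m) * ∑ d ∈ S, 14 ^ d.primeFactors.card) ^ 2 =
      ∑ d ∈ S, ∑ e ∈ S, (2 ^ d.primeFactors.card * (B * ∑ m ∈ S, sieveWeight m)) *
        (2 ^ e.primeFactors.card * (B * ∑ m ∈ S, sieveWeight m)) *
        (E * (7 ^ d.primeFactors.card * 7 ^ e.primeFactors.card)) := by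
    rw [mul_pow, sq (∑ d ∈ S, _), sum_mul_sum, mul_sum, mul_sum]
    refine sum_congr rfl fun d _ => ?_
    rw [mul_sum, mul_sum]
    refine sum_congr rfl fun e _ => ?_
    have h14 : ∀ k : ℕ, (14 : ℝ) ^ k = 2 ^ k * 7 ^ k := fun k => by
      rw [← mul_pow]
      norm_num
    rw [h14, h14]
    ring
  rw [h3]
  refine (abs_sum_le_sum_abs _ _).trans (sum_le_sum fun d hd => ?_)
  rw [mul_sum, ← sum_sub_distrib]
  refine (abs_sum_le_sum_abs _ _).trans (sum_le_sum fun e he => ?_)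
  have h4 : selbergCoeff S y d * selbergCoeff S y e *
      ((I.filter fun t => d ∣ F t ∧ e ∣ F t).card : ℝ) -
      X * (selbergCoeff S y d * selbergCoeff S y e * sieveDensity (d.lcm e)) =
      selbergCoeff S y d * selbergCoeff S y e *
      (((I.filter fun t => d ∣ F t ∧ e ∣ F t).card : ℝ) - X * sieveDensity (d.lcm e)) := by ring
  have h5 := hS.abs_selbergCoeff_le hy hyB hd
  have h6 := hS.abs_selbergCoeff_le hy hyB he
  rw [h4, abs_mul, abs_mul]
  have h7 := (abs_nonneg _).trans h5
  exact mul_le_mul (mul_le_mul h5 h6 (abs_nonneg _) h7) (hcount d hd e he) (abs_nonneg _)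
    (mul_nonneg h7 ((abs_nonneg _).trans h6))

end IsSieveSupport

open Classical in
/-- Squarefree numbers up to `R` all of whose prime factors exceed `D`. -/
noncomputable def sieveSupport (D : ℕ) (R : ℝ) : Finset ℕ :=
  (Icc 1 ⌊R⌋₊).filter fun r => Squarefree r ∧ ∀ p : ℕ, p.Prime → p ∣ r → D < p

/-- The moments of `log (R / r)` with respect to `sieveWeight`. -/
noncomputable def sieveMoment (D : ℕ) (R : ℝ) (j : ℕ) : ℝ :=
  ∑ r ∈ sieveSupport D R, sieveWeight r * Real.log (R / r) ^ j

lemma mem_sieveSupport {D : ℕ} {R : ℝ} {r : ℕ} : r ∈ sieveSupport D R ↔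
    (1 ≤ r ∧ r ≤ ⌊R⌋₊) ∧ Squarefree r ∧ ∀ p : ℕ, p.Prime → p ∣ r → D < p := by
  simp only [sieveSupport, mem_filter, mem_Icc]

lemma isSieveSupport_sieveSupport {D : ℕ} (hD : 14 ≤ D) (R : ℝ) :
    IsSieveSupport (sieveSupport D R) where
  squarefree r hr := (mem_sieveSupport.1 hr).2.1
  large r hr p hp hpr := hD.trans ((mem_sieveSupport.1 hr).2.2 p hp hpr).le
  closed r hr d hd := by
    obtain ⟨⟨h1, h2⟩, h3, h4⟩ := mem_sieveSupport.1 hr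
    exact mem_sieveSupport.2 ⟨⟨Nat.pos_of_dvd_of_pos hd h1, (Nat.le_of_dvd h1 hd).trans h2⟩,
      h3.squarefree_of_dvd hd, fun p hp hpd => h4 p hp (hpd.trans hd)⟩

lemma one_le_div_of_mem_sieveSupport {D : ℕ} {R : ℝ} {r : ℕ} (hr : r ∈ sieveSupport D R) :
    1 ≤ R / r := by
  obtain ⟨⟨h1, h2⟩, -⟩ := mem_sieveSupport.1 hr
  have h3 : (0 : ℝ) < r := by exact_mod_cast h1
  rw [one_le_div h3]
  exact (Nat.le_floor_iff' (by omega)).1 h2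

lemma log_div_nonneg_of_mem_sieveSupport {D : ℕ} {R : ℝ} {r : ℕ} (hr : r ∈ sieveSupport D R) :
    0 ≤ Real.log (R / r) :=
  Real.log_nonneg (one_le_div_of_mem_sieveSupport hr)

lemma seven_div_sub_seven_le {p : ℝ} (hp : 14 ≤ p) : 7 / (p - 7) ≤ 7 / p + 98 / p ^ 2 := by
  have h1 : 0 < p - 7 := by linarith
  have h2 : 0 < p := by linarith
  rw [div_add_div _ _ (by positivity) (by positivity), div_le_div_iff₀ h1 (by positivity)]
  nlinarith [mul_pos h2 h2, mul_nonneg (mul_pos h2 h2).le (sub_nonneg.2 hp), mul_nonneg h2.le (sub_nonneg.2 hp)]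

lemma sum_sieveWeight_mul_log_mul_le {D : ℕ} (hD : 14 ≤ D) (R : ℝ) {g : ℕ → ℝ}
    (hg : ∀ r ∈ sieveSupport D R, 0 ≤ g r) {U : ℕ → ℝ}
    (hU : ∀ m ∈ sieveSupport D R, ∑ p ∈ (Ioc 1 ⌊R / m⌋₊).filter (fun p => p.Prime ∧ D < p),
      7 / ((p : ℝ) - 7) * Real.log p * |g (p * m)| ≤ U m) :
    ∑ r ∈ sieveSupport D R, sieveWeight r * Real.log r * g r ≤
      ∑ m ∈ sieveSupport D R, sieveWeight m * U m := by
  have hS := isSieveSupport_sieveSupport hD R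
  set S := sieveSupport D R with hSdef
  set P := (Ioc 1 ⌊R⌋₊).filter (fun p => p.Prime ∧ D < p) with hP
  have h1 : ∀ r ∈ S, sieveWeight r * Real.log r * g r =
      ∑ p ∈ P, if p ∣ r then sieveWeight r * Real.log p * g r else 0 := fun r hr => by
    have hr' := mem_sieveSupport.1 hr
    have hpf : P.filter (· ∣ r) = r.primeFactors := by
      ext p
      simp only [hP, mem_filter, mem_Ioc, Nat.mem_primeFactors]
      constructor
      · rintro ⟨⟨-, hp, -⟩, hpr⟩
        exact ⟨hp, hpr, hS.ne_zero hr⟩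
      · rintro ⟨hp, hpr, -⟩
        exact ⟨⟨⟨hp.one_lt, (Nat.le_of_dvd hr'.1.1 hpr).trans hr'.1.2⟩, hp, hr'.2.2 p hp hpr⟩, hpr⟩
    have hlog : Real.log r = ∑ p ∈ r.primeFactors, Real.log p := by
      rw [← Real.log_prod fun p hp => by
        exact_mod_cast (Nat.prime_of_mem_primeFactors hp).ne_zero]
      congr 1
      conv_lhs => rw [← Nat.prod_primeFactors_of_squarefree hr'.2.1]
      push_cast
      rfl
    rw [← sum_filter, hpf, hlog, mul_sum, sum_mul]
  have h2 : ∀ p ∈ P, (∑ r ∈ S, if p ∣ r then sieveWeight r * Real.log p * g r else 0) ≤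
      ∑ m ∈ S, if p ≤ ⌊R / m⌋₊ then
        sieveWeight m * (7 / ((p : ℝ) - 7) * Real.log p * |g (p * m)|) else 0 := fun p hp => by
    obtain ⟨hp1, hp, hpD⟩ := mem_filter.1 hp
    have hp7 : 0 < (p : ℝ) - 7 := by
      have : (14 : ℝ) < p := by exact_mod_cast hD.trans_lt hpD
      linarith
    have hlp : 0 ≤ Real.log p := Real.log_natCast_nonneg p
    have h3 : S.filter (p ∣ ·) = (S.filter fun m => ¬ p ∣ m ∧ p * m ∈ S).image (p * ·) := by
      ext m
      simp only [mem_filter, mem_image]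
      constructor
      · rintro ⟨hm, k, rfl⟩
        refine ⟨k, ⟨hS.closed _ hm _ (dvd_mul_left _ _), fun h => ?_, hm⟩, rfl⟩
        exact hp.one_lt.ne' (Nat.isUnit_iff.1 (hS.squarefree _ hm p (Nat.mul_dvd_mul_left p h)))
      · rintro ⟨k, ⟨-, -, hk⟩, rfl⟩
        exact ⟨hk, dvd_mul_right _ _⟩
    rw [← sum_filter, h3, sum_image fun a _ b _ h => Nat.eq_of_mul_eq_mul_left hp.pos h,
      ← sum_filter]
    refine (sum_le_sum (g := fun m => sieveWeight m * (7 / ((p : ℝ) - 7) * Real.log p *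
      |g (p * m)|)) fun m hm => ?_).trans (sum_le_sum_of_subset_of_nonneg
      (fun m hm => ?_) fun m hm _ => ?_)
    · obtain ⟨hm, hpm, hpmS⟩ := mem_filter.1 hm
      rw [sieveWeight, primeProd_mul _ ((hp.coprime_iff_not_dvd).2 hpm), primeProd_prime _ hp,
        abs_of_nonneg (hg _ hpmS)]
      exact le_of_eq (by ring)
    · obtain ⟨hm, hpm, hpmS⟩ := mem_filter.1 hm
      refine mem_filter.2 ⟨hm, ?_⟩
      have h4 := one_le_div_of_mem_sieveSupport hpmS
      have h5 : (0 : ℝ) < m := by exact_mod_cast (mem_sieveSupport.1 hm).1.1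
      have h6 : (0 : ℝ) < p := by exact_mod_cast hp.pos
      push_cast at h4
      rw [one_le_div (by positivity)] at h4
      exact Nat.le_floor ((le_div_iff₀ h5).2 h4)
    · have := hS.weight_pos (mem_filter.1 hm).1
      positivity
  rw [sum_congr rfl h1, sum_comm]
  refine (sum_le_sum h2).trans ?_
  rw [sum_comm]
  refine sum_le_sum fun m hm => ?_
  rw [← sum_filter, ← mul_sum]
  refine mul_le_mul_of_nonneg_left (le_trans (le_of_eq ?_) (hU m hm)) (hS.weight_pos hm).le
  refine sum_congr ?_ fun _ _ => rfl
  ext p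
  simp only [hP, mem_filter, mem_Ioc]
  have h5 : (1 : ℝ) ≤ m := by exact_mod_cast (mem_sieveSupport.1 hm).1.1
  have hR : 0 ≤ R := by
    by_contra h
    have := (mem_sieveSupport.1 hm).1
    rw [Nat.floor_of_nonpos (by linarith)] at this
    omega
  have h6 : ⌊R / m⌋₊ ≤ ⌊R⌋₊ := Nat.floor_le_floor (div_le_self hR h5)
  constructor
  · rintro ⟨⟨⟨a, b⟩, c⟩, d⟩
    exact ⟨⟨a, d⟩, c⟩
  · rintro ⟨⟨a, d⟩, c⟩
    exact ⟨⟨⟨a, d.trans h6⟩, c⟩, d⟩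

/-- Sums over large primes against `7 / (p - 7)`. -/
lemma sum_seven_div_sub_seven_le {K : ℝ} (hK : ∀ s : Finset ℕ, ∑ n ∈ s, Real.log n / (n : ℝ) ^ 2 ≤ K)
    {D : ℕ} (hD : 14 ≤ D) {z B : ℝ} {f : ℕ → ℝ}
    (hf : ∀ n ∈ Ioc 1 ⌊z⌋₊, 0 ≤ f n ∧ f n ≤ B) (hB : 0 ≤ B) :
    ∑ p ∈ (Ioc 1 ⌊z⌋₊).filter (fun p => p.Prime ∧ D < p),
      7 / ((p : ℝ) - 7) * Real.log p * f p ≤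
      7 * ∑ n ∈ Ioc 1 ⌊z⌋₊, mertensTerm n * f n + 98 * K * B := by
  have h1 : ∀ p ∈ (Ioc 1 ⌊z⌋₊).filter (fun p => p.Prime ∧ D < p),
      7 / ((p : ℝ) - 7) * Real.log p * f p ≤
      7 * (mertensTerm p * f p) + 98 * B * (Real.log p / (p : ℝ) ^ 2) := fun p hp => by
    obtain ⟨hp1, hp, hpD⟩ := mem_filter.1 hp
    have hp14 : (14 : ℝ) ≤ p := by exact_mod_cast (hD.trans_lt hpD).le
    have hlp : 0 ≤ Real.log p := Real.log_natCast_nonneg p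
    obtain ⟨h2, h3⟩ := hf p hp1
    rw [mertensTerm, if_pos hp]
    calc 7 / ((p : ℝ) - 7) * Real.log p * f p
        ≤ (7 / p + 98 / (p : ℝ) ^ 2) * Real.log p * f p := by
          gcongr
          exact seven_div_sub_seven_le hp14
      _ = 7 * (Real.log p / p * f p) + 98 * f p * (Real.log p / (p : ℝ) ^ 2) := by ring
      _ ≤ _ := by gcongr
  refine (sum_le_sum h1).trans ?_
  rw [sum_add_distrib, ← mul_sum, ← mul_sum]
  have h2 : ∑ p ∈ (Ioc 1 ⌊z⌋₊).filter (fun p => p.Prime ∧ D < p), mertensTerm p * f p ≤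
      ∑ n ∈ Ioc 1 ⌊z⌋₊, mertensTerm n * f n :=
    sum_le_sum_of_subset_of_nonneg (filter_subset _ _) fun n hn _ =>
      mul_nonneg (mertensTerm_nonneg n) (hf n hn).1
  have h3 := mul_le_mul_of_nonneg_left (hK ((Ioc 1 ⌊z⌋₊).filter (fun p => p.Prime ∧ D < p)))
    (show 0 ≤ 98 * B by positivity)
  linarith

lemma log_eq_log_add_log_div {D : ℕ} {R : ℝ} {r : ℕ} (hr : r ∈ sieveSupport D R) :
    Real.log R = Real.log r + Real.log (R / r) := by
  have h3 : (0 : ℝ) < r := by exact_mod_cast (mem_sieveSupport.1 hr).1.1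
  have h4 := one_le_div_of_mem_sieveSupport hr
  rw [← Real.log_mul h3.ne' (by linarith)]
  congr 1
  field_simp

lemma exists_log_mul_sieveMoment_le : ∃ C : ℝ, 1 ≤ C ∧ ∀ D : ℕ, 14 ≤ D → ∀ R : ℝ,
    Real.log R * sieveMoment D R 0 ≤ 8 * sieveMoment D R 1 + C * sieveMoment D R 0 ∧
    Real.log R * sieveMoment D R 1 ≤ 9 / 2 * sieveMoment D R 2 + C * sieveMoment D R 1 := by
  obtain ⟨K, hK0, hK⟩ := exists_sum_log_div_sq_le
  obtain ⟨C₁, hC₁, h₁⟩ := sum_mertensTerm_le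
  obtain ⟨C₂, hC₂, h₂⟩ := sum_mertensTerm_mul_log_div_le
  refine ⟨7 * C₁ + 7 * C₂ + 98 * K, by linarith, fun D hD R => ⟨?_, ?_⟩⟩
  · have h := sum_sieveWeight_mul_log_mul_le hD R (g := fun _ => 1) (fun _ _ => zero_le_one)
      (U := fun m => 7 * Real.log (R / m) + (7 * C₁ + 98 * K)) fun m hm => by
        have h4 := sum_seven_div_sub_seven_le hK hD (z := R / m) (B := 1) (f := fun _ => 1)
          (fun n _ => ⟨zero_le_one, le_rfl⟩) zero_le_one
        have h5 := h₁ (R / m) (one_le_div_of_mem_sieveSupport hm)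
        simp only [mul_one, abs_one] at h4 ⊢
        linarith
    have hM0 : 0 ≤ sieveMoment D R 0 := sum_nonneg fun r hr => by
      have := (isSieveSupport_sieveSupport hD R).weight_pos hr
      positivity
    have e1 : Real.log R * sieveMoment D R 0 =
        ∑ r ∈ sieveSupport D R, sieveWeight r * Real.log r * 1 + sieveMoment D R 1 := by
      rw [sieveMoment, sieveMoment, mul_sum, ← sum_add_distrib]
      refine sum_congr rfl fun r hr => ?_
      rw [log_eq_log_add_log_div hr]
      ring
    have e2 : ∑ m ∈ sieveSupport D R, sieveWeight m * (7 * Real.log (R / m) + (7 * C₁ + 98 * K)) =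
        7 * sieveMoment D R 1 + (7 * C₁ + 98 * K) * sieveMoment D R 0 := by
      rw [sieveMoment, sieveMoment, mul_sum, mul_sum, ← sum_add_distrib]
      exact sum_congr rfl fun r hr => by ring
    rw [e2] at h
    nlinarith
  · have h := sum_sieveWeight_mul_log_mul_le hD R (g := fun r => Real.log (R / r))
      (fun r hr => log_div_nonneg_of_mem_sieveSupport hr)
      (U := fun m => 7 / 2 * Real.log (R / m) ^ 2 + (7 * C₂ + 98 * K) * Real.log (R / m))
      fun m hm => by
        have hz := one_le_div_of_mem_sieveSupport hm
        have hm0 : (0 : ℝ) < m := by exact_mod_cast (mem_sieveSupport.1 hm).1.1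
        have h6 : ∀ n ∈ Ioc 1 ⌊R / m⌋₊, 0 ≤ Real.log (R / m / n) ∧
            Real.log (R / m / n) ≤ Real.log (R / m) := fun n hn => by
          obtain ⟨hn1, hn2⟩ := mem_Ioc.1 hn
          have hn0 : (1 : ℝ) ≤ n := by exact_mod_cast hn1.le
          have hn3 : (n : ℝ) ≤ R / m := (Nat.le_floor_iff' (by omega)).1 hn2
          have h7 : 1 ≤ R / m / n := (one_le_div (by linarith)).2 hn3
          exact ⟨Real.log_nonneg h7,
            Real.log_le_log (by linarith) (div_le_self (by linarith) hn0)⟩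
        have h4 := sum_seven_div_sub_seven_le hK hD (z := R / m) (B := Real.log (R / m))
          (f := fun n => Real.log (R / m / n)) h6 (Real.log_nonneg hz)
        have h5 := h₂ (R / m) hz
        have h8 : ∀ p ∈ (Ioc 1 ⌊R / m⌋₊).filter (fun p => p.Prime ∧ D < p),
            7 / ((p : ℝ) - 7) * Real.log p * |Real.log (R / (p * m : ℕ))| =
            7 / ((p : ℝ) - 7) * Real.log p * Real.log (R / m / p) := fun p hp => by
          have e : R / ((p * m : ℕ) : ℝ) = R / m / p := by
            push_cast
            rw [div_div, mul_comm]
          rw [e, abs_of_nonneg (h6 p (mem_filter.1 hp).1).1]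
        rw [sum_congr rfl h8]
        linarith
    have hM1 : 0 ≤ sieveMoment D R 1 := sum_nonneg fun r hr => by
      have := (isSieveSupport_sieveSupport hD R).weight_pos hr
      have := log_div_nonneg_of_mem_sieveSupport hr
      positivity
    have e1 : Real.log R * sieveMoment D R 1 =
        ∑ r ∈ sieveSupport D R, sieveWeight r * Real.log r * Real.log (R / r)
          + sieveMoment D R 2 := by
      rw [sieveMoment, sieveMoment, mul_sum, ← sum_add_distrib]
      refine sum_congr rfl fun r hr => ?_
      rw [log_eq_log_add_log_div hr]
      ring
    have e2 : ∑ m ∈ sieveSupport D R, sieveWeight m *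
        (7 / 2 * Real.log (R / m) ^ 2 + (7 * C₂ + 98 * K) * Real.log (R / m)) =
        7 / 2 * sieveMoment D R 2 + (7 * C₂ + 98 * K) * sieveMoment D R 1 := by
      rw [sieveMoment, sieveMoment, mul_sum, mul_sum, ← sum_add_distrib]
      exact sum_congr rfl fun r hr => by ring
    rw [e2] at h
    nlinarith

lemma sieveMoment_zero_le : ∃ C : ℝ, 1 ≤ C ∧ ∀ D : ℕ, 14 ≤ D → ∀ R : ℝ, 3 ≤ R →
    sieveMoment D R 0 ≤ C * Real.log R ^ 7 := by
  obtain ⟨K, hK0, hK⟩ := exists_sum_log_div_sq_le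
  obtain ⟨C₁, hC₁, h₁⟩ := sum_inv_prime_le
  refine ⟨Real.exp (7 * C₁ + 98 * K), Real.one_le_exp (by positivity), fun D hD R hR => ?_⟩
  set P := (Ioc 1 ⌊R⌋₊).filter (fun p => p.Prime ∧ D < p) with hP
  have h14 : ∀ p ∈ P, (14 : ℝ) ≤ p := fun p hp => by
    exact_mod_cast (hD.trans_lt (mem_filter.1 hp).2.2).le
  have h2 : sieveMoment D R 0 ≤ ∏ p ∈ P, (1 + 7 / ((p : ℝ) - 7)) := by
    rw [prod_one_add, sieveMoment]
    have h3 : Set.InjOn Nat.primeFactors (sieveSupport D R : Set ℕ) := fun a ha b hb h => by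
      have ha := (mem_sieveSupport.1 ha).2.1
      have hb := (mem_sieveSupport.1 hb).2.1
      rw [← Nat.prod_primeFactors_of_squarefree ha, ← Nat.prod_primeFactors_of_squarefree hb, h]
    have h4 : ∑ r ∈ sieveSupport D R, sieveWeight r * Real.log (R / r) ^ 0 =
        ∑ s ∈ (sieveSupport D R).image Nat.primeFactors, ∏ p ∈ s, 7 / ((p : ℝ) - 7) := by
      rw [sum_image h3]
      exact sum_congr rfl fun r _ => by simp [sieveWeight, primeProd]
    rw [h4]
    refine sum_le_sum_of_subset_of_nonneg (fun s hs => ?_) fun s hs _ => ?_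
    · obtain ⟨r, hr, rfl⟩ := mem_image.1 hs
      obtain ⟨h5, h6, h7⟩ := mem_sieveSupport.1 hr
      refine mem_powerset.2 fun p hp => mem_filter.2 ?_
      have hpp := Nat.prime_of_mem_primeFactors hp
      have hpd := Nat.dvd_of_mem_primeFactors hp
      exact ⟨mem_Ioc.2 ⟨hpp.one_lt, (Nat.le_of_dvd h5.1 hpd).trans h5.2⟩, hpp, h7 p hpp hpd⟩
    · refine prod_nonneg fun p hp => ?_
      have := h14 p (mem_powerset.1 hs hp)
      exact div_nonneg (by norm_num) (by linarith)
  have h3 : ∏ p ∈ P, (1 + 7 / ((p : ℝ) - 7)) ≤ Real.exp (∑ p ∈ P, 7 / ((p : ℝ) - 7)) := by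
    rw [Real.exp_sum]
    refine prod_le_prod (fun p hp => ?_) fun p hp => ?_
    · have := h14 p hp
      have : 0 ≤ 7 / ((p : ℝ) - 7) := div_nonneg (by norm_num) (by linarith)
      linarith
    · linarith [Real.add_one_le_exp (7 / ((p : ℝ) - 7))]
  have h4 : ∑ p ∈ P, 7 / ((p : ℝ) - 7) ≤
      ∑ p ∈ P, (7 * (1 / (p : ℝ)) + 98 * (Real.log p / (p : ℝ) ^ 2)) := sum_le_sum fun p hp => by
    have h5 := h14 p hp
    refine (seven_div_sub_seven_le h5).trans ?_
    have h6 : 1 ≤ Real.log p := by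
      rw [Real.le_log_iff_exp_le (by linarith)]
      linarith [Real.exp_one_lt_d9]
    have h7 : 98 * (1 / (p : ℝ) ^ 2) ≤ 98 * (Real.log p / (p : ℝ) ^ 2) := by gcongr
    calc _ = 7 * (1 / (p : ℝ)) + 98 * (1 / (p : ℝ) ^ 2) := by ring
      _ ≤ _ := by linarith
  have h5 : ∑ p ∈ P, 1 / (p : ℝ) ≤ Real.log (Real.log R) + C₁ := by
    refine le_trans (sum_le_sum_of_subset_of_nonneg (fun p hp => ?_) fun p _ _ => by positivity)
      (h₁ R hR)
    exact mem_filter.2 ⟨(mem_filter.1 hp).1, (mem_filter.1 hp).2.1⟩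
  have hL : 0 < Real.log R := Real.log_pos (by linarith)
  rw [sum_add_distrib, ← mul_sum, ← mul_sum] at h4
  have h6 : ∑ p ∈ P, 7 / ((p : ℝ) - 7) ≤ (7 * C₁ + 98 * K) + 7 * Real.log (Real.log R) := by
    have := hK P
    linarith
  refine h2.trans (h3.trans ((Real.exp_le_exp.2 h6).trans (le_of_eq ?_)))
  rw [Real.exp_add]
  congr 1
  rw [mul_comm, Real.exp_mul, Real.exp_log hL]
  exact_mod_cast Real.rpow_natCast _ 7

lemma one_le_sieveMoment_zero {D : ℕ} (hD : 14 ≤ D) {R : ℝ} (hR : 1 ≤ R) :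
    1 ≤ sieveMoment D R 0 := by
  have h1 : 1 ∈ sieveSupport D R := mem_sieveSupport.2 ⟨⟨le_rfl, Nat.le_floor (by simpa)⟩,
    squarefree_one, fun p hp h => absurd (Nat.dvd_one.1 h) hp.ne_one⟩
  refine le_trans (le_of_eq ?_) (single_le_sum (f := fun r : ℕ => sieveWeight r *
    Real.log (R / r) ^ 0) (fun r hr => ?_) h1)
  · simp [sieveWeight]
  · have := (isSieveSupport_sieveSupport hD R).weight_pos hr
    positivity

lemma log_le_tangent {v s : ℝ} (hs2 : s ≤ 1 / 2) (hv0 : 0 < v)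
    (hv : s ≤ (1 - s) * v) : Real.log v ≤ (v - 1) * (1 - s + s / v) := by
  rcases le_total 1 v with h | h
  · have h1 : Real.log v ≤ Real.sinh (Real.log v) := Real.self_le_sinh_iff.2 (Real.log_nonneg h)
    rw [Real.sinh_log hv0] at h1
    refine h1.trans ?_
    rw [← sub_nonneg]
    have : (v - 1) * (1 - s + s / v) - (v - v⁻¹) / 2 = (v - 1) ^ 2 * (1 / 2 - s) / v := by
      field_simp
      ring
    rw [this]
    have : 0 ≤ 1 / 2 - s := by linarith
    positivity
  · have h1 : 0 ≤ 1 / v - 1 := by rw [sub_nonneg, one_le_div hv0]; exact h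
    have h2 := Real.le_log_one_add_of_nonneg h1
    rw [show 1 + (1 / v - 1) = v⁻¹ by ring, Real.log_inv] at h2
    have h3 : Real.log v ≤ -(2 * (1 / v - 1) / (1 / v - 1 + 2)) := by linarith
    refine h3.trans ?_
    rw [← sub_nonneg]
    have : (v - 1) * (1 - s + s / v) - -(2 * (1 / v - 1) / (1 / v - 1 + 2)) =
        (1 - v) * (1 - v) * ((1 - s) * v - s) / (v * (v + 1)) := by
      have : 1 / v - 1 + 2 ≠ 0 := by linarith
      have e : 2 * (1 / v - 1) / (1 / v - 1 + 2) = 2 * (1 - v) / (1 + v) := by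
        rw [div_eq_div_iff this (by linarith)]
        field_simp
        ring
      rw [e]
      field_simp
      ring
    rw [this]
    have h4 : 0 ≤ 1 - v := by linarith
    have h5 : 0 ≤ (1 - s) * v - s := by linarith
    positivity

lemma log_sub_half_add_inv_le {u : ℝ} (hu : 9 / 4 ≤ u) :
    Real.log u - 1 / 2 + 1 / u ≤ 27 / 14 - 73 / 81 + 584 / 6561 * u := by
  have h1 := log_le_tangent (v := u * (8 / 81)) (s := 8 / 81) (by norm_num)
    (by linarith) (by linarith)
  have h2 : Real.log u = Real.log (u * (8 / 81)) + 3 * Real.log 2 + 2 * Real.log (9 / 8) := by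
    have e : u = u * (8 / 81) * 2 ^ 3 * (9 / 8) ^ 2 := by ring
    have h3 : (u * (8 / 81)) ≠ 0 := by positivity
    conv_lhs => rw [e]
    rw [Real.log_mul (by positivity) (by positivity), Real.log_mul (by positivity) (by positivity),
      Real.log_pow, Real.log_pow]
    push_cast
    ring
  have h3 := Real.log_two_lt_d9
  have h4 := Real.log_le_sub_one_of_pos (show (0 : ℝ) < 9 / 8 by norm_num)
  have h5 : (u * (8 / 81) - 1) * (1 - 8 / 81 + 8 / 81 / (u * (8 / 81))) =
      584 / 6561 * u - 73 / 81 + 8 / 81 - 1 / u := by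
    have : u ≠ 0 := by linarith
    field_simp
    ring
  linarith

/-- The prime sum over differences of the diagonal variables, for one `m` with `ℓ = log (R / m)`. -/
lemma exists_sum_prime_min_sq_le : ∃ C : ℝ, 1 ≤ C ∧ ∀ D : ℕ, 14 ≤ D → ∀ z y : ℝ, 1 ≤ z →
    z ≤ y → 1 < y → 9 / 4 * Real.log z ≤ Real.log y →
    ∑ p ∈ (Ioc 1 ⌊y⌋₊).filter (fun p => p.Prime ∧ D < p),
      7 / (p : ℝ) * (1 - Real.log p / Real.log y) * min (Real.log p) (Real.log z) ^ 2 ≤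
      7 * (27 / 14 - 73 / 81) * Real.log z ^ 2 +
        7 * (584 / 6561) * Real.log y * Real.log z + C * Real.log z := by
  obtain ⟨C₁, hC₁, h₁⟩ := sum_mertensTerm_mul_log_le
  obtain ⟨C₂, hC₂, h₂⟩ := sum_mertensTerm_mul_inv_log_sub_le
  refine ⟨7 * C₁ + 7 * C₂, by linarith, fun D hD z y hz hzy hy hY => ?_⟩
  have hY0 : 0 < Real.log y := Real.log_pos hy
  rcases hz.eq_or_lt with rfl | hz
  · refine le_of_eq_of_le (sum_eq_zero fun p hp => ?_) (by simp)
    rw [Real.log_one, min_eq_right (Real.log_natCast_nonneg p)]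
    ring
  have hl : 0 < Real.log z := Real.log_pos hz
  set ℓ := Real.log z with hℓ
  set Y := Real.log y with hYdef
  set P := (Ioc 1 ⌊y⌋₊).filter (fun p => p.Prime ∧ D < p) with hP
  have hpos : ∀ p ∈ P, 1 < p ∧ 0 < Real.log p ∧ Real.log p ≤ Y := fun p hp => by
    obtain ⟨h1, h2⟩ := mem_Ioc.1 (mem_filter.1 hp).1
    have h3 : (1 : ℝ) < p := by exact_mod_cast h1
    exact ⟨h1, Real.log_pos h3, Real.log_le_log (by linarith)
      ((Nat.le_floor_iff' (by omega)).1 h2)⟩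
  have hA : ∑ p ∈ P with p ≤ ⌊z⌋₊, 7 / (p : ℝ) * (1 - Real.log p / Y) *
      min (Real.log p) ℓ ^ 2 ≤ 7 * (ℓ ^ 2 / 2 + C₁ * ℓ) := by
    refine le_trans ?_ (mul_le_mul_of_nonneg_left (h₁ z hz.le) (by norm_num))
    rw [mul_sum]
    refine (sum_le_sum (g := fun n : ℕ => 7 * (mertensTerm n * Real.log n)) fun p hp => ?_).trans
      (sum_le_sum_of_subset_of_nonneg (fun p hp => ?_) fun n _ _ => ?_)
    · obtain ⟨hp, -⟩ := mem_filter.1 hp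
      obtain ⟨h1, h2, h3⟩ := hpos p hp
      rw [mertensTerm, if_pos (mem_filter.1 hp).2.1]
      have h4 : 0 ≤ min (Real.log p) ℓ := le_min h2.le hl.le
      have h5 : 1 - Real.log p / Y ≤ 1 := by
        have : 0 ≤ Real.log p / Y := by positivity
        linarith
      calc 7 / (p : ℝ) * (1 - Real.log p / Y) * min (Real.log p) ℓ ^ 2
          ≤ 7 / (p : ℝ) * 1 * Real.log p ^ 2 := by
            gcongr
            exact min_le_left _ _
        _ = _ := by ring
    · obtain ⟨hp, hpz⟩ := mem_filter.1 hp
      exact mem_Ioc.2 ⟨(hpos p hp).1, hpz⟩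
    · have := mertensTerm_nonneg n
      have := Real.log_natCast_nonneg n
      positivity
  have hB : ∑ p ∈ P with ¬ p ≤ ⌊z⌋₊, 7 / (p : ℝ) * (1 - Real.log p / Y) *
      min (Real.log p) ℓ ^ 2 ≤ 7 * ℓ ^ 2 * (Real.log (Y / ℓ) - 1 + ℓ / Y + C₂ / ℓ) := by
    refine le_trans ?_ (mul_le_mul_of_nonneg_left (h₂ z y hz hzy) (by positivity))
    rw [mul_sum]
    have h0 : ∀ n ∈ Ioc ⌊z⌋₊ ⌊y⌋₊, 0 < Real.log n ∧ 0 ≤ 1 / Real.log n - 1 / Y := fun n hn => by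
      obtain ⟨h1, h2⟩ := mem_Ioc.1 hn
      have h5 : z < n := (Nat.floor_lt (by linarith)).1 h1
      have h6 : 0 < Real.log n := Real.log_pos (by linarith)
      have h7 : Real.log n ≤ Y := Real.log_le_log (by linarith)
        ((Nat.le_floor_iff' (by omega)).1 h2)
      exact ⟨h6, sub_nonneg.2 (one_div_le_one_div_of_le h6 h7)⟩
    refine (sum_le_sum (g := fun n : ℕ => 7 * ℓ ^ 2 * (mertensTerm n * (1 / Real.log n - 1 / Y)))
      fun p hp => ?_).trans
      (sum_le_sum_of_subset_of_nonneg (fun p hp => ?_) fun n hn _ => ?_)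
    · obtain ⟨hp, hpz⟩ := mem_filter.1 hp
      obtain ⟨h1, h2, h3⟩ := hpos p hp
      rw [mertensTerm, if_pos (mem_filter.1 hp).2.1]
      have h4 : 0 ≤ min (Real.log p) ℓ := le_min h2.le hl.le
      have h5 : 0 ≤ 1 - Real.log p / Y := by
        rw [sub_nonneg, div_le_one hY0]
        exact h3
      calc 7 / (p : ℝ) * (1 - Real.log p / Y) * min (Real.log p) ℓ ^ 2
          ≤ 7 / (p : ℝ) * (1 - Real.log p / Y) * ℓ ^ 2 := by
            gcongr
            exact min_le_right _ _
        _ = _ := by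
            field_simp
    · obtain ⟨hp, hpz⟩ := mem_filter.1 hp
      exact mem_Ioc.2 ⟨not_le.1 hpz, (mem_Ioc.1 (mem_filter.1 hp).1).2⟩
    · have := mertensTerm_nonneg n
      have := (h0 n hn).2
      positivity
  rw [← sum_filter_add_sum_filter_not P (fun p => p ≤ ⌊z⌋₊)]
  have h4 := log_sub_half_add_inv_le (u := Y / ℓ) ((le_div_iff₀ hl).2 hY)
  have h5 := mul_le_mul_of_nonneg_left h4 (show 0 ≤ 7 * ℓ ^ 2 by positivity)
  have e1 : 7 * ℓ ^ 2 * (27 / 14 - 73 / 81 + 584 / 6561 * (Y / ℓ)) =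
      7 * (27 / 14 - 73 / 81) * ℓ ^ 2 + 7 * (584 / 6561) * Y * ℓ := by
    field_simp
  have e2 : 7 * ℓ ^ 2 * (Real.log (Y / ℓ) - 1 + ℓ / Y + C₂ / ℓ) =
      7 * ℓ ^ 2 * (Real.log (Y / ℓ) - 1 / 2 + 1 / (Y / ℓ)) - 7 * ℓ ^ 2 / 2 + 7 * C₂ * ℓ := by
    field_simp
    ring
  rw [e1] at h5
  rw [e2] at hB
  linarith

/-- The logarithmic weights of the sieve lose fewer than `14` prime factors on average. -/
lemma exists_sum_sieveWeight_prime_le : ∃ C : ℝ, 1 ≤ C ∧ ∀ D : ℕ, 14 ≤ D → ∀ R y : ℝ, 1 < R →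
    R ≤ y → Real.log y = 9 / 4 * Real.log R →
    ∑ m ∈ sieveSupport D R, sieveWeight m *
      ∑ p ∈ (Ioc 1 ⌊y⌋₊).filter (fun p => p.Prime ∧ D < p),
        7 / (p : ℝ) * (1 - Real.log p / Real.log y) *
          min (Real.log p) (Real.log (R / m)) ^ 2 ≤
      27 / 2 * sieveMoment D R 2 + C * sieveMoment D R 1 := by
  obtain ⟨C₁, hC₁, h₁⟩ := exists_log_mul_sieveMoment_le
  obtain ⟨C₂, hC₂, h₂⟩ := exists_sum_prime_min_sq_le
  refine ⟨2 * C₁ + C₂, by linarith, fun D hD R y hR hRy hY => ?_⟩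
  have h3 : ∀ m ∈ sieveSupport D R, sieveWeight m *
      ∑ p ∈ (Ioc 1 ⌊y⌋₊).filter (fun p => p.Prime ∧ D < p),
        7 / (p : ℝ) * (1 - Real.log p / Real.log y) *
          min (Real.log p) (Real.log (R / m)) ^ 2 ≤
      7 * (27 / 14 - 73 / 81) * (sieveWeight m * Real.log (R / m) ^ 2) +
        (7 * (584 / 6561) * Real.log y + C₂) * (sieveWeight m * Real.log (R / m) ^ 1) :=
    fun m hm => by
      have hw := (isSieveSupport_sieveSupport hD R).weight_pos hm
      have hz := one_le_div_of_mem_sieveSupport hm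
      have hm1 : (1 : ℝ) ≤ m := by exact_mod_cast (mem_sieveSupport.1 hm).1.1
      have hzR : R / m ≤ R := div_le_self (by linarith) hm1
      have h4 := h₂ D hD (R / m) y hz (hzR.trans hRy) (by linarith) (by
        rw [hY]
        have := Real.log_le_log (by linarith) hzR
        linarith)
      refine (mul_le_mul_of_nonneg_left h4 hw.le).trans (le_of_eq ?_)
      ring
  refine (sum_le_sum h3).trans ?_
  rw [sum_add_distrib, ← mul_sum, ← mul_sum]
  change 7 * (27 / 14 - 73 / 81) * sieveMoment D R 2 +
    (7 * (584 / 6561) * Real.log y + C₂) * sieveMoment D R 1 ≤ _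
  have hM1 : 0 ≤ sieveMoment D R 1 := sum_nonneg fun r hr => by
    have := (isSieveSupport_sieveSupport hD R).weight_pos hr
    have := log_div_nonneg_of_mem_sieveSupport hr
    positivity
  have h5 := (h₁ D hD R).2
  rw [hY]
  have h6 : 0 ≤ C₁ * sieveMoment D R 1 := by positivity
  nlinarith

/-- A sequence without prime factors up to `D` whose multiples of moduli composed of larger primes
are distributed like the values of a product of seven linear forms. -/
structure IsSieveSequence (F : ℕ → ℕ) (D : ℕ) : Prop where
  not_dvd : ∀ p : ℕ, p.Prime → p ≤ D → ∀ t, ¬ p ∣ F t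
  count : ∀ m : ℕ, m ≠ 0 → (∀ p : ℕ, p.Prime → p ∣ m → D < p) → ∀ T : ℕ,
    |(((Ico T (2 * T)).filter fun t => m ∣ F t).card : ℝ) -
      T * (7 ^ m.primeFactors.card / m)| ≤ 7 ^ m.primeFactors.card

/-- The diagonal variables of the sieve. -/
noncomputable def sieveVar (R : ℝ) (r : ℕ) : ℝ := max 0 (Real.log (R / r))

/-- The Selberg sum of the sieve over the divisors of `N`. -/
noncomputable def sieveSum (D : ℕ) (R : ℝ) (N : ℕ) : ℝ :=
  ∑ d ∈ sieveSupport D R with d ∣ N, selbergCoeff (sieveSupport D R) (sieveVar R) d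

/-- The error term of the sieve. -/
noncomputable def sieveError (D : ℕ) (R : ℝ) : ℝ :=
  ((Real.log R * sieveMoment D R 0) * ∑ d ∈ sieveSupport D R, 14 ^ d.primeFactors.card) ^ 2

lemma sieveDensity_eq {n : ℕ} (hn : Squarefree n) :
    sieveDensity n = 7 ^ n.primeFactors.card / n := by
  rw [sieveDensity, primeProd, prod_div_distrib, prod_const]
  congr 1
  conv_rhs => rw [← Nat.prod_primeFactors_of_squarefree hn]
  push_cast
  rfl

lemma card_primeFactors_lcm_le {d e : ℕ} (hd : d ≠ 0) (he : e ≠ 0) :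
    (d.lcm e).primeFactors.card ≤ d.primeFactors.card + e.primeFactors.card := by
  rw [primeFactors_lcm_eq_union hd he]
  exact card_union_le _ _

lemma squarefree_lcm {d e : ℕ} (hd : Squarefree d) (he : Squarefree e) :
    Squarefree (d.lcm e) := by
  have h0 : d.lcm e ≠ 0 := Nat.lcm_ne_zero hd.ne_zero he.ne_zero
  rw [Nat.squarefree_iff_factorization_le_one h0]
  intro p
  rw [Nat.factorization_lcm hd.ne_zero he.ne_zero]
  exact max_le (hd.natFactorization_le_one p) (he.natFactorization_le_one p)

lemma sieveVar_of_mem {D : ℕ} {R : ℝ} {r : ℕ} (hr : r ∈ sieveSupport D R) :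
    sieveVar R r = Real.log (R / r) :=
  max_eq_right (log_div_nonneg_of_mem_sieveSupport hr)

lemma log_div_le_log_of_mem {D : ℕ} {R : ℝ} {r : ℕ} (hr : r ∈ sieveSupport D R) :
    Real.log (R / r) ≤ Real.log R := by
  have := log_eq_log_add_log_div hr
  have := Real.log_natCast_nonneg r
  linarith

lemma sieveMoment_two_eq (D : ℕ) (R : ℝ) :
    ∑ m ∈ sieveSupport D R, sieveWeight m * sieveVar R m ^ 2 = sieveMoment D R 2 :=
  sum_congr rfl fun m hm => by rw [sieveVar_of_mem hm]

lemma sum_sieveWeight_eq (D : ℕ) (R : ℝ) :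
    ∑ m ∈ sieveSupport D R, sieveWeight m = sieveMoment D R 0 :=
  sum_congr rfl fun m _ => by rw [pow_zero, mul_one]

lemma abs_sum_sieveSum_sq_sub_le {F : ℕ → ℕ} {D : ℕ} (hF : IsSieveSequence F D) (hD : 14 ≤ D)
    (R : ℝ) (T : ℕ) :
    |∑ t ∈ Ico T (2 * T), sieveSum D R (F t) ^ 2 - T * sieveMoment D R 2| ≤ sieveError D R := by
  have hS := isSieveSupport_sieveSupport hD R
  have h := hS.abs_sum_sq_sub_le (y := sieveVar R) (B := Real.log R)
    (fun m _ => le_max_left _ _) (fun m hm => by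
      rw [sieveVar_of_mem hm]
      exact log_div_le_log_of_mem hm) (Ico T (2 * T)) F (X := T) (E := 1) fun d hd e he => by
      have hd0 := hS.ne_zero hd
      have he0 := hS.ne_zero he
      have h1 := hF.count (d.lcm e) (Nat.lcm_ne_zero hd0 he0) (fun p hp hpd => by
        rcases hp.dvd_lcm.1 hpd with h | h
        · exact (mem_sieveSupport.1 hd).2.2 p hp h
        · exact (mem_sieveSupport.1 he).2.2 p hp h) T
      rw [sieveDensity_eq (squarefree_lcm (hS.squarefree d hd) (hS.squarefree e he))]
      simp only [← Nat.lcm_dvd_iff]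
      refine h1.trans ?_
      rw [one_mul, ← pow_add]
      exact pow_le_pow_right₀ (by norm_num) (card_primeFactors_lcm_le hd0 he0)
  rw [sieveMoment_two_eq, sum_sieveWeight_eq, one_mul] at h
  exact h

lemma sieveVar_sub_sieveVar {D : ℕ} {R : ℝ} {m p : ℕ} (hm : m ∈ sieveSupport D R)
    (hp : 0 < p) :
    sieveVar R m - sieveVar R (p * m) = min (Real.log p) (Real.log (R / m)) := by
  have h1 := one_le_div_of_mem_sieveSupport hm
  have hp0 : (0 : ℝ) < p := by exact_mod_cast hp
  have e : R / ((p * m : ℕ) : ℝ) = R / m / p := by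
    push_cast
    rw [div_div, mul_comm]
  rw [sieveVar_of_mem hm, sieveVar, e, Real.log_div (by linarith) hp0.ne']
  rcases le_total (Real.log p) (Real.log (R / m)) with h | h
  · rw [min_eq_left h, max_eq_right (by linarith)]
    ring
  · rw [min_eq_right h, max_eq_left (by linarith)]
    ring

lemma sieveVar_mul_eq_zero {D : ℕ} {R : ℝ} {m p : ℕ} (hm : m ∈ sieveSupport D R)
    (hp : p.Prime) (hpD : D < p) (hpm : ¬ p ∣ m) (hpmS : p * m ∉ sieveSupport D R) :
    sieveVar R (p * m) = 0 := by
  have hp0 : (0 : ℝ) < p := by exact_mod_cast hp.pos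
  obtain ⟨⟨h1, h2⟩, h3, h4⟩ := mem_sieveSupport.1 hm
  have hm0 : (0 : ℝ) < m := by exact_mod_cast h1
  have h5 : ¬ p * m ≤ ⌊R⌋₊ := fun h => hpmS <| mem_sieveSupport.2
    ⟨⟨Nat.mul_pos hp.pos h1, h⟩, (Nat.squarefree_mul ((hp.coprime_iff_not_dvd).2 hpm)).2
      ⟨hp.prime.squarefree, h3⟩, fun q hq hqd => by
        rcases hq.dvd_mul.1 hqd with h | h
        · rwa [(Nat.prime_dvd_prime_iff_eq hq hp).1 h]
        · exact h4 q hq h⟩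
  have h6 := one_le_div_of_mem_sieveSupport hm
  have hR : 0 < R := by
    have := (one_le_div hm0).1 h6
    linarith
  have h7 : R < (p * m : ℕ) := (Nat.floor_lt hR.le).1 (not_le.1 h5)
  have h8 : (0 : ℝ) < (p * m : ℕ) := hR.trans h7
  exact max_eq_left (Real.log_nonpos (by positivity) ((div_le_one h8).2 h7.le))

/-- The sieve weights on multiples of `q = p ^ k`. -/
lemma sum_sieveSum_sq_of_dvd_le {F : ℕ → ℕ} {D : ℕ} (hF : IsSieveSequence F D) (hD : 14 ≤ D)
    {R : ℝ} (hR : 1 ≤ R) (T : ℕ) {p k : ℕ} (hp : p.Prime) (hpD : D < p) (hk : k ≠ 0) :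
    ∑ t ∈ (Ico T (2 * T)).filter (fun t => p ^ k ∣ F t), sieveSum D R (F t) ^ 2 ≤
      T * (7 / (p : ℝ) ^ k) * ∑ m ∈ sieveSupport D R, sieveWeight m *
        min (Real.log p) (Real.log (R / m)) ^ 2 + 7 * sieveError D R := by
  have hS := isSieveSupport_sieveSupport hD R
  set S := sieveSupport D R with hSdef
  have hS' := hS.filter_not_dvd p
  set S' := S.filter fun r => ¬ p ∣ r with hS'def
  have hsub : S' ⊆ S := filter_subset _ _
  have hlp : 0 ≤ Real.log p := Real.log_natCast_nonneg p
  have hmin : ∀ m ∈ S, 0 ≤ min (Real.log p) (Real.log (R / m)) := fun m hm =>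
    le_min hlp (log_div_nonneg_of_mem_sieveSupport hm)
  have hL : 0 ≤ Real.log R := Real.log_nonneg hR
  have h := hS'.abs_sum_sq_sub_le (y := fun m => sieveVar R m - sieveVar R (p * m))
    (B := Real.log R)
    (fun m hm => by
      simp only [sieveVar_sub_sieveVar (hsub hm) hp.pos]
      exact hmin m (hsub hm))
    (fun m hm => by
      simp only [sieveVar_sub_sieveVar (hsub hm) hp.pos]
      exact (min_le_right _ _).trans (log_div_le_log_of_mem (hsub hm)))
    ((Ico T (2 * T)).filter fun t => p ^ k ∣ F t) F (X := T * (7 / (p : ℝ) ^ k)) (E := 7)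
    fun d hd e he => by
      have hd0 := hS'.ne_zero hd
      have he0 := hS'.ne_zero he
      have hl0 := Nat.lcm_ne_zero hd0 he0
      have hpl : ¬ p ∣ d.lcm e := fun h => by
        rcases hp.dvd_lcm.1 h with h | h
        · exact (mem_filter.1 hd).2 h
        · exact (mem_filter.1 he).2 h
      have hc : (p ^ k).Coprime (d.lcm e) := ((hp.coprime_iff_not_dvd).2 hpl).pow_left k
      have h1 := hF.count (p ^ k * d.lcm e) (mul_ne_zero (pow_ne_zero _ hp.ne_zero) hl0)
        (fun q hq hqd => by
          rcases hq.dvd_mul.1 hqd with h | h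
          · rwa [(Nat.prime_dvd_prime_iff_eq hq hp).1 (hq.dvd_of_dvd_pow h)]
          · rcases hq.dvd_lcm.1 h with h | h
            · exact (mem_sieveSupport.1 (hsub hd)).2.2 q hq h
            · exact (mem_sieveSupport.1 (hsub he)).2.2 q hq h) T
      rw [hc.primeFactors_mul, card_union_of_disjoint hc.disjoint_primeFactors,
        Nat.primeFactors_prime_pow hk hp, card_singleton, pow_add, pow_one] at h1
      have h2 : (((Ico T (2 * T)).filter fun t => p ^ k ∣ F t).filter
          fun t => d ∣ F t ∧ e ∣ F t) =
          (Ico T (2 * T)).filter fun t => p ^ k * d.lcm e ∣ F t := by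
        rw [filter_filter]
        refine filter_congr fun t _ => ?_
        rw [← Nat.lcm_dvd_iff]
        exact ⟨fun h => hc.mul_dvd_of_dvd_of_dvd h.1 h.2,
          fun h => ⟨(dvd_mul_right _ _).trans h, (dvd_mul_left _ _).trans h⟩⟩
      rw [h2, sieveDensity_eq (squarefree_lcm (hS'.squarefree d hd) (hS'.squarefree e he))]
      have e1 : (T : ℝ) * (7 / (p : ℝ) ^ k) *
          (7 ^ (d.lcm e).primeFactors.card / (d.lcm e : ℕ)) =
          T * (7 * 7 ^ (d.lcm e).primeFactors.card / ((p ^ k * d.lcm e : ℕ) : ℝ)) := by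
        push_cast
        rw [mul_assoc, div_mul_div_comm]
      rw [e1]
      refine h1.trans ?_
      rw [← pow_add]
      gcongr
      · norm_num
      · exact card_primeFactors_lcm_le hd0 he0
  have h3 : ∑ t ∈ (Ico T (2 * T)).filter (fun t => p ^ k ∣ F t), sieveSum D R (F t) ^ 2 =
      ∑ t ∈ (Ico T (2 * T)).filter (fun t => p ^ k ∣ F t), (∑ d ∈ S' with d ∣ F t,
        selbergCoeff S' (fun m => sieveVar R m - sieveVar R (p * m)) d) ^ 2 := by
    refine sum_congr rfl fun t ht => ?_
    rw [sieveSum, hS.sum_selbergCoeff_of_dvd (sieveVar R) hp (by omega)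
      (fun m hm hpm hpmS => sieveVar_mul_eq_zero hm hp hpD hpm hpmS)
      ((dvd_pow_self p hk).trans (mem_filter.1 ht).2)]
  rw [h3]
  have h4 : ∑ m ∈ S', sieveWeight m * (sieveVar R m - sieveVar R (p * m)) ^ 2 ≤
      ∑ m ∈ S, sieveWeight m * min (Real.log p) (Real.log (R / m)) ^ 2 := by
    refine (sum_le_sum fun m hm => le_of_eq ?_).trans
      (sum_le_sum_of_subset_of_nonneg hsub fun m hm _ => ?_)
    · rw [sieveVar_sub_sieveVar (hsub hm) hp.pos]
    · have := hS.weight_pos hm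
      positivity
  have h5 : 7 * ((Real.log R * ∑ m ∈ S', sieveWeight m) *
      ∑ d ∈ S', (14 : ℝ) ^ d.primeFactors.card) ^ 2 ≤ 7 * sieveError D R := by
    have h6 : ∑ m ∈ S', sieveWeight m ≤ sieveMoment D R 0 := by
      rw [← sum_sieveWeight_eq]
      exact sum_le_sum_of_subset_of_nonneg hsub fun m hm _ => (hS.weight_pos hm).le
    have h7 : ∑ d ∈ S', (14 : ℝ) ^ d.primeFactors.card ≤
        ∑ d ∈ S, (14 : ℝ) ^ d.primeFactors.card :=
      sum_le_sum_of_subset_of_nonneg hsub fun m hm _ => by positivity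
    have h8 : 0 ≤ ∑ m ∈ S', sieveWeight m :=
      sum_nonneg fun m hm => (hS'.weight_pos hm).le
    have h9 : 0 ≤ sieveMoment D R 0 := h8.trans h6
    rw [sieveError]
    gcongr
  have h6 : 0 ≤ (T : ℝ) * (7 / (p : ℝ) ^ k) := by positivity
  have h7 := mul_le_mul_of_nonneg_left h4 h6
  have h8 := (abs_le.1 h).2
  linarith

lemma fourteen_pow_card_le {D : ℕ} (hD : 14 ^ 16 ≤ D) {R : ℝ} {d : ℕ}
    (hd : d ∈ sieveSupport D R) : (14 : ℝ) ^ d.primeFactors.card ≤ R ^ (1 / 16 : ℝ) := by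
  obtain ⟨⟨h1, h2⟩, h3, h4⟩ := mem_sieveSupport.1 hd
  have h5 : (14 ^ 16) ^ d.primeFactors.card ≤ d := by
    conv_rhs => rw [← Nat.prod_primeFactors_of_squarefree h3]
    rw [← prod_const]
    exact prod_le_prod' fun p hp => hD.trans
      (h4 p (Nat.prime_of_mem_primeFactors hp) (Nat.dvd_of_mem_primeFactors hp)).le
  have h6 : (((14 : ℝ) ^ d.primeFactors.card) ^ 16) ≤ R := by
    rw [pow_right_comm]
    exact le_trans (by exact_mod_cast h5) ((Nat.le_floor_iff' (by omega)).1 h2)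
  have h7 : (14 : ℝ) ^ d.primeFactors.card =
      (((14 : ℝ) ^ d.primeFactors.card) ^ 16) ^ (1 / 16 : ℝ) := by
    rw [← Real.rpow_natCast _ 16, ← Real.rpow_mul (by positivity)]
    norm_num
  rw [h7]
  exact Real.rpow_le_rpow (by positivity) h6 (by norm_num)

lemma sieveError_le {D : ℕ} (hD : 14 ^ 16 ≤ D) {R : ℝ} (hR : 1 ≤ R) :
    sieveError D R ≤ (Real.log R * sieveMoment D R 0) ^ 2 * R ^ (17 / 8 : ℝ) := by
  have hR0 : 0 < R := by linarith
  have h1 : ∑ d ∈ sieveSupport D R, (14 : ℝ) ^ d.primeFactors.card ≤ R ^ (17 / 16 : ℝ) := by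
    refine (sum_le_card_nsmul _ _ _ fun d hd => fourteen_pow_card_le hD hd).trans ?_
    have h2 : ((sieveSupport D R).card : ℝ) ≤ R := by
      have : (sieveSupport D R).card ≤ ⌊R⌋₊ := by
        classical
        exact (card_filter_le _ _).trans (by simp)
      exact le_trans (by exact_mod_cast this) (Nat.floor_le hR0.le)
    rw [nsmul_eq_mul, show (17 / 16 : ℝ) = 1 + 1 / 16 by norm_num, Real.rpow_add hR0,
      Real.rpow_one]
    gcongr
  rw [sieveError, mul_pow, show (17 / 8 : ℝ) = 17 / 16 * (2 : ℕ) by norm_num, Real.rpow_mul hR0.le,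
    Real.rpow_natCast]
  have h0 : 0 ≤ ∑ d ∈ sieveSupport D R, (14 : ℝ) ^ d.primeFactors.card :=
    sum_nonneg fun d _ => by positivity
  gcongr

/-- The primes in `(D, y]`. -/
noncomputable def sievePrimes (D : ℕ) (y : ℝ) : Finset ℕ :=
  (Ioc 1 ⌊y⌋₊).filter fun p => p.Prime ∧ D < p

/-- The logarithmically weighted number of prime factors up to `y`, with a penalty for repeated
prime factors. -/
noncomputable def sieveLoss (D : ℕ) (y : ℝ) (N : ℕ) : ℝ :=
  ∑ p ∈ sievePrimes D y, ((if p ∣ N then 1 - Real.log p / Real.log y else 0) +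
    if p ^ 2 ∣ N then 14 else 0)

lemma mem_sievePrimes {D : ℕ} {y : ℝ} {p : ℕ} :
    p ∈ sievePrimes D y ↔ (1 < p ∧ p ≤ ⌊y⌋₊) ∧ p.Prime ∧ D < p := by
  rw [sievePrimes, mem_filter, mem_Ioc]

lemma log_div_log_le_one_of_mem {D : ℕ} {y : ℝ} (hy : 1 < y) {p : ℕ} (hp : p ∈ sievePrimes D y) :
    0 ≤ Real.log p / Real.log y ∧ Real.log p / Real.log y ≤ 1 := by
  obtain ⟨⟨h1, h2⟩, -⟩ := mem_sievePrimes.1 hp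
  have hY := Real.log_pos hy
  have h3 : (1 : ℝ) < p := by exact_mod_cast h1
  have h4 : (p : ℝ) ≤ y := (Nat.le_floor_iff' (by omega)).1 h2
  exact ⟨div_nonneg (Real.log_nonneg h3.le) hY.le,
    (div_le_one hY).2 (Real.log_le_log (by linarith) h4)⟩

lemma sum_inv_sq_le {k n : ℕ} (hk : 0 < k) : ∑ p ∈ Ioc k n, 1 / (p : ℝ) ^ 2 ≤ 1 / (k : ℝ) := by
  rcases le_total k n with h | h
  · have h1 := sum_Ioc_inv_sq_le_sub (α := ℝ) hk.ne' h
    have h2 : (0 : ℝ) ≤ (n : ℝ)⁻¹ := by positivity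
    simp only [one_div]
    linarith
  · rw [Ioc_eq_empty_of_le h, sum_empty]
    positivity

lemma exists_le_sum_sieveSum_sq_mul : ∃ C : ℝ, 1 ≤ C ∧ ∀ (F : ℕ → ℕ) (D : ℕ),
    IsSieveSequence F D → 14 ^ 16 ≤ D → ∀ R y : ℝ, 1 < R → R ≤ y →
    Real.log y = 9 / 4 * Real.log R → ∀ T : ℕ,
    T * (sieveMoment D R 2 / 8 - C * sieveMoment D R 1) - 120 * y * sieveError D R ≤
      ∑ t ∈ Ico T (2 * T), sieveSum D R (F t) ^ 2 * (55 / 4 - sieveLoss D y (F t)) := by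
  obtain ⟨C, hC, h⟩ := exists_sum_sieveWeight_prime_le
  refine ⟨C, hC, fun F D hF hD R y hR hRy hY T => ?_⟩
  have hD14 : 14 ≤ D := le_trans (by norm_num) hD
  have hS := isSieveSupport_sieveSupport hD14 R
  have hy : 1 < y := hR.trans_le hRy
  set S := sieveSupport D R with hSdef
  set P := sievePrimes D y with hP
  set E := sieveError D R with hE
  have hE0 : 0 ≤ E := sq_nonneg _
  set A : ℕ → ℝ := fun p => ∑ m ∈ S, sieveWeight m *
    min (Real.log p) (Real.log (R / m)) ^ 2 with hA
  have hA0 : ∀ p, A p ≤ sieveMoment D R 2 := fun p => sum_le_sum fun m hm => by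
    have h1 := hS.weight_pos hm
    have h2 := log_div_nonneg_of_mem_sieveSupport hm
    have h3 : 0 ≤ min (Real.log p) (Real.log (R / m)) :=
      le_min (Real.log_natCast_nonneg p) h2
    gcongr
    exact min_le_right _ _
  have hw := (abs_le.1 (abs_sum_sieveSum_sq_sub_le hF hD14 R T)).1
  have hM2 : 0 ≤ sieveMoment D R 2 := sum_nonneg fun r hr => by
    have := hS.weight_pos hr
    positivity
  have hloss : ∑ t ∈ Ico T (2 * T), sieveSum D R (F t) ^ 2 * sieveLoss D y (F t) =
      ∑ p ∈ P, ((1 - Real.log p / Real.log y) *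
        ∑ t ∈ (Ico T (2 * T)).filter (fun t => p ^ 1 ∣ F t), sieveSum D R (F t) ^ 2 +
        14 * ∑ t ∈ (Ico T (2 * T)).filter (fun t => p ^ 2 ∣ F t), sieveSum D R (F t) ^ 2) := by
    simp only [sieveLoss, mul_sum]
    rw [sum_comm]
    refine sum_congr rfl fun p _ => ?_
    rw [sum_filter, sum_filter, ← sum_add_distrib]
    refine sum_congr rfl fun t _ => ?_
    simp only [pow_one]
    split_ifs <;> ring
  have hterm : ∀ p ∈ P, (1 - Real.log p / Real.log y) *
        ∑ t ∈ (Ico T (2 * T)).filter (fun t => p ^ 1 ∣ F t), sieveSum D R (F t) ^ 2 +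
        14 * ∑ t ∈ (Ico T (2 * T)).filter (fun t => p ^ 2 ∣ F t), sieveSum D R (F t) ^ 2 ≤
      T * (7 / (p : ℝ) * (1 - Real.log p / Real.log y) * A p) +
        98 * T * sieveMoment D R 2 * (1 / (p : ℝ) ^ 2) + 105 * E := fun p hp => by
    obtain ⟨-, hpp, hpD⟩ := mem_sievePrimes.1 hp
    obtain ⟨h1, h2⟩ := log_div_log_le_one_of_mem hy hp
    have h3 := sum_sieveSum_sq_of_dvd_le hF hD14 hR.le T hpp hpD one_ne_zero
    have h4 := sum_sieveSum_sq_of_dvd_le hF hD14 hR.le T hpp hpD two_ne_zero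
    change _ ≤ T * (7 / (p : ℝ) ^ 1) * A p + 7 * E at h3
    change _ ≤ T * (7 / (p : ℝ) ^ 2) * A p + 7 * E at h4
    have h5 := mul_le_mul_of_nonneg_left h3 (sub_nonneg.2 h2)
    have h6 : (T : ℝ) * (7 / (p : ℝ) ^ 2) * A p ≤
        T * (7 / (p : ℝ) ^ 2) * sieveMoment D R 2 := by
      gcongr
      exact hA0 p
    have h7 : (1 - Real.log p / Real.log y) * (7 * E) ≤ 7 * E := by
      have : 0 ≤ Real.log p / Real.log y * (7 * E) := by positivity
      linarith
    have h8 : (1 - Real.log p / Real.log y) * (T * (7 / (p : ℝ) ^ 1) * A p + 7 * E) =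
        T * (7 / (p : ℝ) * (1 - Real.log p / Real.log y) * A p) +
        (1 - Real.log p / Real.log y) * (7 * E) := by
      rw [pow_one]
      ring
    have h9 : 98 * T * sieveMoment D R 2 * (1 / (p : ℝ) ^ 2) =
        14 * (T * (7 / (p : ℝ) ^ 2) * sieveMoment D R 2) := by ring
    linarith
  have hsum := (sum_le_sum hterm)
  rw [← hloss, sum_add_distrib, sum_add_distrib, ← mul_sum, ← mul_sum, sum_const,
    nsmul_eq_mul] at hsum
  have h1 : ∑ p ∈ P, 7 / (p : ℝ) * (1 - Real.log p / Real.log y) * A p ≤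
      27 / 2 * sieveMoment D R 2 + C * sieveMoment D R 1 := by
    refine le_trans (le_of_eq ?_) (h D hD14 R y hR hRy hY)
    simp only [hA, mul_sum]
    rw [sum_comm]
    refine sum_congr rfl fun m _ => sum_congr rfl fun p _ => ?_
    ring
  have h2 : 98 * (T : ℝ) * sieveMoment D R 2 * ∑ p ∈ P, 1 / (p : ℝ) ^ 2 ≤
      T * (sieveMoment D R 2 / 8) := by
    have h3 : ∑ p ∈ P, 1 / (p : ℝ) ^ 2 ≤ 1 / 784 := by
      have h4 : ∑ p ∈ P, 1 / (p : ℝ) ^ 2 ≤ ∑ p ∈ Ioc D ⌊y⌋₊, 1 / (p : ℝ) ^ 2 :=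
        sum_le_sum_of_subset_of_nonneg (fun p hp => by
          obtain ⟨⟨-, h5⟩, -, h6⟩ := mem_sievePrimes.1 hp
          exact mem_Ioc.2 ⟨h6, h5⟩) fun _ _ _ => by positivity
      refine h4.trans ((sum_inv_sq_le (by omega)).trans ?_)
      have : (784 : ℝ) ≤ D := by exact_mod_cast le_trans (by norm_num) hD
      gcongr
    calc _ ≤ 98 * (T : ℝ) * sieveMoment D R 2 * (1 / 784) := by gcongr
      _ = _ := by ring
  have h3 : (P.card : ℝ) * (105 * E) ≤ y * (105 * E) := by
    have h4 : P.card ≤ ⌊y⌋₊ := (card_filter_le _ _).trans (by simp)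
    have h5 : (P.card : ℝ) ≤ y := le_trans (by exact_mod_cast h4) (Nat.floor_le (by linarith))
    gcongr
  have h4 := mul_le_mul_of_nonneg_left h1 (Nat.cast_nonneg (α := ℝ) T)
  have h5 : 0 ≤ (y - 1) * E := mul_nonneg (by linarith) hE0
  have h6 : ∑ t ∈ Ico T (2 * T), sieveSum D R (F t) ^ 2 * (55 / 4 - sieveLoss D y (F t)) =
      55 / 4 * ∑ t ∈ Ico T (2 * T), sieveSum D R (F t) ^ 2 -
      ∑ t ∈ Ico T (2 * T), sieveSum D R (F t) ^ 2 * sieveLoss D y (F t) := by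
    rw [mul_sum, ← sum_sub_distrib]
    exact sum_congr rfl fun t _ => by ring
  rw [h6]
  nlinarith

lemma log_div_log_nonneg_terms {D : ℕ} {y : ℝ} (hy : 1 < y) (N : ℕ) {p : ℕ}
    (hp : p ∈ sievePrimes D y) :
    0 ≤ (if p ∣ N then 1 - Real.log p / Real.log y else 0) := by
  split_ifs
  · linarith [(log_div_log_le_one_of_mem hy hp).2]
  · exact le_rfl

lemma sieveLoss_nonneg {D : ℕ} {y : ℝ} (hy : 1 < y) (N : ℕ) : 0 ≤ sieveLoss D y N :=
  sum_nonneg fun p hp => add_nonneg (log_div_log_nonneg_terms hy N hp) (by split_ifs <;> norm_num)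

lemma not_sq_dvd_of_sieveLoss_lt {D : ℕ} {y : ℝ} (hy : 1 < y) {N : ℕ}
    (h : sieveLoss D y N < 55 / 4) {p : ℕ} (hp : p ∈ sievePrimes D y) : ¬ p ^ 2 ∣ N := fun hpN => by
  have h1 := single_le_sum (f := fun p => ((if p ∣ N then 1 - Real.log p / Real.log y else 0) +
    if p ^ 2 ∣ N then (14 : ℝ) else 0)) (fun q hq => add_nonneg (log_div_log_nonneg_terms hy N hq)
      (by split_ifs <;> norm_num)) hp
  have h2 := log_div_log_nonneg_terms hy N hp
  simp only [if_pos hpN] at h1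
  change _ ≤ sieveLoss D y N at h1
  linarith

lemma card_primeFactors_le_of_sieveLoss_lt {D : ℕ} {y : ℝ} (hy : 1 < y) {N : ℕ} (hN : N ≠ 0)
    (hND : ∀ p : ℕ, p.Prime → p ≤ D → ¬ p ∣ N)
    (hlog : Real.log N ≤ 57 / 4 * Real.log y) (h : sieveLoss D y N < 55 / 4) :
    N.primeFactors.card ≤ 27 := by
  have hY := Real.log_pos hy
  have h1 : ∑ p ∈ N.primeFactors, (1 - Real.log p / Real.log y) ≤ sieveLoss D y N := by
    have h2 : ∑ p ∈ N.primeFactors, (1 - Real.log p / Real.log y) ≤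
        ∑ p ∈ (sievePrimes D y).filter (· ∣ N), (1 - Real.log p / Real.log y) := by
      have h3 : (sievePrimes D y).filter (· ∣ N) ⊆ N.primeFactors := fun p hp => by
        obtain ⟨hp, hpN⟩ := mem_filter.1 hp
        exact Nat.mem_primeFactors.2 ⟨(mem_sievePrimes.1 hp).2.1, hpN, hN⟩
      rw [← sum_sdiff h3]
      have h4 : ∑ p ∈ N.primeFactors \ (sievePrimes D y).filter (· ∣ N),
          (1 - Real.log p / Real.log y) ≤ 0 := sum_nonpos fun p hp => by
        obtain ⟨hp1, hp2⟩ := mem_sdiff.1 hp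
        obtain ⟨hpp, hpN, -⟩ := Nat.mem_primeFactors.1 hp1
        have h5 : ¬ p ≤ ⌊y⌋₊ := fun h5 => hp2 <| mem_filter.2 ⟨mem_sievePrimes.2
          ⟨⟨hpp.one_lt, h5⟩, hpp, not_le.1 fun h6 => hND p hpp h6 hpN⟩, hpN⟩
        have h6 : y < p := (Nat.floor_lt (by linarith)).1 (not_le.1 h5)
        have h7 : 1 ≤ Real.log p / Real.log y :=
          (one_le_div hY).2 (Real.log_le_log (by linarith) h6.le)
        linarith
      linarith
    refine h2.trans ?_
    rw [sum_filter]
    refine sum_le_sum fun p hp => ?_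
    have : (0 : ℝ) ≤ if p ^ 2 ∣ N then 14 else 0 := by split_ifs <;> norm_num
    linarith
  have h2 : ∑ p ∈ N.primeFactors, Real.log p / Real.log y ≤ 57 / 4 := by
    rw [← sum_div, div_le_iff₀ hY]
    refine le_trans ?_ hlog
    rw [← Real.log_prod fun p hp => by
      exact_mod_cast (Nat.prime_of_mem_primeFactors hp).ne_zero]
    have h3 : ∏ p ∈ N.primeFactors, p ≤ N :=
      Nat.le_of_dvd (Nat.pos_of_ne_zero hN) (Nat.prod_primeFactors_dvd N)
    rw [← Nat.cast_prod]
    have h4 : 0 < ∏ p ∈ N.primeFactors, p :=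
      prod_pos fun p hp => (Nat.prime_of_mem_primeFactors hp).pos
    refine Real.log_le_log (by exact_mod_cast h4) (by exact_mod_cast h3)
  have h3 : (N.primeFactors.card : ℝ) = ∑ p ∈ N.primeFactors, (1 - Real.log p / Real.log y) +
      ∑ p ∈ N.primeFactors, Real.log p / Real.log y := by
    rw [← sum_add_distrib]
    simp
  have h4 : (N.primeFactors.card : ℝ) < 28 := by linarith
  have h5 : N.primeFactors.card < 28 := by exact_mod_cast h4
  omega

lemma sieveSum_sq_le {D : ℕ} (hD : 14 ≤ D) (R : ℝ) {N : ℕ} (hN : N ≠ 0)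
    (h : N.primeFactors.card ≤ 27) :
    sieveSum D R N ^ 2 ≤ (2 ^ 54 * (Real.log R * sieveMoment D R 0)) ^ 2 := by
  have hS := isSieveSupport_sieveSupport hD R
  rw [sq_le_sq]
  refine le_trans ?_ (le_abs_self _)
  rw [sieveSum]
  rcases ((sieveSupport D R).filter (· ∣ N)).eq_empty_or_nonempty with h0 | h0
  · rw [h0, sum_empty, abs_zero]
    by_cases h1 : (sieveSupport D R).Nonempty
    · obtain ⟨r, hr⟩ := h1
      have h2 : 0 ≤ sieveMoment D R 0 := sum_nonneg fun r hr => by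
        have := hS.weight_pos hr
        positivity
      have h3 := (log_div_nonneg_of_mem_sieveSupport hr).trans (log_div_le_log_of_mem hr)
      positivity
    · rw [sieveMoment, not_nonempty_iff_eq_empty.1 h1]
      simp
  obtain ⟨r, hr⟩ := h0
  have hr := (mem_filter.1 hr).1
  have hM0 : 0 ≤ sieveMoment D R 0 := sum_nonneg fun r hr => by
    have := hS.weight_pos hr
    positivity
  have hL := (log_div_nonneg_of_mem_sieveSupport hr).trans (log_div_le_log_of_mem hr)
  have h1 : ∀ d ∈ (sieveSupport D R).filter (· ∣ N),
      |selbergCoeff (sieveSupport D R) (sieveVar R) d| ≤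
        2 ^ 27 * (Real.log R * sieveMoment D R 0) := fun d hd => by
    obtain ⟨hd, hdN⟩ := mem_filter.1 hd
    have h2 := hS.abs_selbergCoeff_le (y := sieveVar R) (B := Real.log R)
      (fun m _ => le_max_left _ _) (fun m hm => by
        rw [sieveVar_of_mem hm]
        exact log_div_le_log_of_mem hm) hd
    rw [sum_sieveWeight_eq] at h2
    refine h2.trans ?_
    gcongr
    · norm_num
    · exact (card_le_card (Nat.primeFactors_mono hdN hN)).trans h
  have h2 : ((sieveSupport D R).filter (· ∣ N)).card ≤ 2 ^ 27 := by
    refine le_trans ?_ (Nat.pow_le_pow_right (by norm_num) h)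
    rw [← card_powerset]
    refine card_le_card_of_injOn Nat.primeFactors (fun d hd => ?_) fun a ha b hb hab => ?_
    · exact mem_powerset.2 (Nat.primeFactors_mono (mem_filter.1 hd).2 hN)
    · have ha := hS.squarefree a (mem_filter.1 ha).1
      have hb := hS.squarefree b (mem_filter.1 hb).1
      rw [← Nat.prod_primeFactors_of_squarefree ha, ← Nat.prod_primeFactors_of_squarefree hb, hab]
  have h2' : (((sieveSupport D R).filter (· ∣ N)).card : ℝ) ≤ 2 ^ 27 := by exact_mod_cast h2
  refine (abs_sum_le_sum_abs _ _).trans ((sum_le_card_nsmul _ _ _ h1).trans ?_)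
  rw [nsmul_eq_mul]
  calc _ ≤ (2 : ℝ) ^ 27 * (2 ^ 27 * (Real.log R * sieveMoment D R 0)) := by gcongr
    _ = _ := by ring

lemma sum_sieveSum_sq_mul_le {F : ℕ → ℕ} {D : ℕ} (hF : IsSieveSequence F D) (hD : 14 ≤ D)
    (R : ℝ) {y : ℝ} (hy : 1 < y) {T : ℕ}
    (hFT : ∀ t ∈ Ico T (2 * T), F t ≠ 0 ∧ Real.log (F t) ≤ 57 / 4 * Real.log y) :
    ∑ t ∈ Ico T (2 * T), sieveSum D R (F t) ^ 2 * (55 / 4 - sieveLoss D y (F t)) ≤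
      ((Ico T (2 * T)).filter fun t => (F t).primeFactors.card ≤ 27 ∧
        ∀ p ∈ sievePrimes D y, ¬ p ^ 2 ∣ F t).card *
        (14 * (2 ^ 54 * (Real.log R * sieveMoment D R 0)) ^ 2) := by
  rw [← nsmul_eq_mul, ← sum_const, sum_filter]
  refine sum_le_sum fun t ht => ?_
  obtain ⟨h0, hlog⟩ := hFT t ht
  by_cases h : sieveLoss D y (F t) < 55 / 4
  · have h1 := card_primeFactors_le_of_sieveLoss_lt hy h0
      (fun p hp hpD => hF.not_dvd p hp hpD t) hlog h
    rw [if_pos ⟨h1, fun p hp => not_sq_dvd_of_sieveLoss_lt hy h hp⟩]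
    have h2 := sieveSum_sq_le hD R h0 h1
    have h3 := sieveLoss_nonneg (D := D) hy (F t)
    calc _ ≤ (2 ^ 54 * (Real.log R * sieveMoment D R 0)) ^ 2 * 14 := by
          gcongr
          linarith
      _ = _ := mul_comm _ _
  · have h1 : sieveSum D R (F t) ^ 2 * (55 / 4 - sieveLoss D y (F t)) ≤ 0 :=
      mul_nonpos_of_nonneg_of_nonpos (sq_nonneg _) (by linarith)
    refine h1.trans ?_
    split_ifs <;> positivity

lemma eventually_mul_log_pow_le_rpow (A : ℝ) {s : ℝ} (hs : 0 < s) :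
    ∀ᶠ T : ℕ in Filter.atTop, A * Real.log T ^ 7 ≤ (T : ℝ) ^ s := by
  have h1 := isLittleO_log_rpow_rpow_atTop 7 hs
  have h2 : ∀ᶠ x : ℝ in Filter.atTop, A * Real.log x ^ 7 ≤ x ^ s := by
    have h3 := h1.bound (show (0 : ℝ) < 1 / (|A| + 1) by positivity)
    filter_upwards [h3, Filter.eventually_ge_atTop 1] with x hx hx1
    have hl := Real.log_nonneg hx1
    rw [show (7 : ℝ) = (7 : ℕ) by norm_num, Real.rpow_natCast, Real.norm_of_nonneg (by positivity),
      Real.norm_of_nonneg (by positivity), one_div, inv_mul_eq_div, le_div_iff₀ (by positivity)] at hx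
    refine le_trans ?_ hx
    rw [mul_comm]
    gcongr
    linarith [le_abs_self A]
  exact tendsto_natCast_atTop_atTop.eventually h2

lemma eventually_le_log (A : ℝ) : ∀ᶠ T : ℕ in Filter.atTop, A ≤ Real.log T :=
  (Real.tendsto_log_atTop.comp tendsto_natCast_atTop_atTop).eventually_ge_atTop A

namespace IsSieveSequence

variable {F : ℕ → ℕ} {D : ℕ}

lemma card_sq_dvd_le (hF : IsSieveSequence F D) {k : ℕ} (hk : 0 < k) (N T : ℕ) :
    (((Ico T (2 * T)).filter fun t => ∃ p ∈ Ioc k N, p.Prime ∧ D < p ∧ p ^ 2 ∣ F t).card : ℝ) ≤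
      7 * T / k + 7 * N := by
  have h1 : ((Ico T (2 * T)).filter fun t => ∃ p ∈ Ioc k N, p.Prime ∧ D < p ∧ p ^ 2 ∣ F t) ⊆
      ((Ioc k N).filter fun p => p.Prime ∧ D < p).biUnion
        fun p => (Ico T (2 * T)).filter fun t => p ^ 2 ∣ F t := fun t ht => by
    obtain ⟨ht, p, hp, hpp, hpD, hpt⟩ := mem_filter.1 ht
    exact mem_biUnion.2 ⟨p, mem_filter.2 ⟨hp, hpp, hpD⟩, mem_filter.2 ⟨ht, hpt⟩⟩
  have h2 : ∀ p ∈ (Ioc k N).filter (fun p => p.Prime ∧ D < p),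
      (((Ico T (2 * T)).filter fun t => p ^ 2 ∣ F t).card : ℝ) ≤ 7 * T * (1 / (p : ℝ) ^ 2) + 7 :=
    fun p hp => by
      obtain ⟨-, hpp, hpD⟩ := mem_filter.1 hp
      have h3 := (abs_le.1 (hF.count (p ^ 2) (pow_ne_zero _ hpp.ne_zero) (fun q hq hqd => by
        rwa [(Nat.prime_dvd_prime_iff_eq hq hpp).1 (hq.dvd_of_dvd_pow hqd)]) T)).2
      rw [Nat.primeFactors_prime_pow two_ne_zero hpp, card_singleton] at h3
      push_cast at h3
      have e : (T : ℝ) * (7 ^ 1 / (p : ℝ) ^ 2) = 7 * T * (1 / (p : ℝ) ^ 2) := by ring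
      linarith
  have h3 : ∑ p ∈ (Ioc k N).filter (fun p => p.Prime ∧ D < p), (7 * T * (1 / (p : ℝ) ^ 2) + 7) ≤
      ∑ p ∈ Ioc k N, (7 * T * (1 / (p : ℝ) ^ 2) + 7) :=
    sum_le_sum_of_subset_of_nonneg (filter_subset _ _) fun _ _ _ => by positivity
  calc _ ≤ ((((Ioc k N).filter fun p => p.Prime ∧ D < p).biUnion
        fun p => (Ico T (2 * T)).filter fun t => p ^ 2 ∣ F t).card : ℝ) := by
        exact_mod_cast card_le_card h1
    _ ≤ ∑ p ∈ (Ioc k N).filter (fun p => p.Prime ∧ D < p),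
        (((Ico T (2 * T)).filter fun t => p ^ 2 ∣ F t).card : ℝ) := by
        exact_mod_cast card_biUnion_le
    _ ≤ _ := (sum_le_sum h2).trans h3
    _ ≤ 7 * T / k + 7 * N := by
        rw [sum_add_distrib, ← mul_sum, sum_const, nsmul_eq_mul, Nat.card_Ioc]
        have h4 := sum_inv_sq_le (k := k) (n := N) hk
        have h5 : ((N - k : ℕ) : ℝ) ≤ N := by exact_mod_cast Nat.sub_le N k
        have h6 := mul_le_mul_of_nonneg_left h4 (show 0 ≤ 7 * (T : ℝ) by positivity)
        have e : 7 * (T : ℝ) * (1 / k) = 7 * T / k := by ring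
        linarith

/-- A positive proportion, on the logarithmic scale, of the terms have few prime factors and no
repeated prime factor up to `√T`. -/
lemma exists_le_card_primeFactors (hF : IsSieveSequence F D) (hD : 14 ^ 16 ≤ D) {K : ℝ}
    (hK : 1 ≤ K) {t₀ : ℕ} (hpos : ∀ t, t₀ ≤ t → F t ≠ 0)
    (hle : ∀ t, t₀ ≤ t → (F t : ℝ) ≤ K * (t : ℝ) ^ 7) :
    ∃ c : ℝ, 0 < c ∧ ∀ᶠ T : ℕ in Filter.atTop, c * T / Real.log T ^ 7 ≤
      ((Ico T (2 * T)).filter fun t => (F t).primeFactors.card ≤ 27 ∧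
        ∀ p ∈ sievePrimes D ((T : ℝ) ^ (1 / 2 : ℝ)), ¬ p ^ 2 ∣ F t).card := by
  obtain ⟨C₁, hC₁, h₁⟩ := exists_log_mul_sieveMoment_le
  obtain ⟨C₂, hC₂, h₂⟩ := exists_le_sum_sieveSum_sq_mul
  obtain ⟨C₃, hC₃, h₃⟩ := sieveMoment_zero_le
  refine ⟨1 / (20160 * 2 ^ 108 * C₃), by positivity, ?_⟩
  filter_upwards [Filter.eventually_ge_atTop (max t₀ 2), eventually_le_log (9 / 2 * Real.log 3),
    eventually_le_log (8 * (Real.log K + 7 * Real.log 2)), eventually_le_log (45 * C₁),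
    eventually_le_log (360 * C₂),
    eventually_mul_log_pow_le_rpow (172800 * C₃) (show (0 : ℝ) < 1 / 36 by norm_num)]
    with T hT hT3 hTK hT1 hT2 hT4
  have hD14 : 14 ≤ D := le_trans (by norm_num) hD
  have hTt : t₀ ≤ T := (le_max_left _ _).trans hT
  have hT2' : (2 : ℝ) ≤ T := by exact_mod_cast (le_max_right _ _).trans hT
  have hT0 : (0 : ℝ) < T := by linarith
  set x : ℝ := (T : ℝ) with hx
  set R : ℝ := x ^ (2 / 9 : ℝ) with hR
  set y : ℝ := x ^ (1 / 2 : ℝ) with hy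
  have hlogR : Real.log R = 2 / 9 * Real.log x := Real.log_rpow hT0 _
  have hlogy : Real.log y = 1 / 2 * Real.log x := Real.log_rpow hT0 _
  have hlx : 0 < Real.log x := Real.log_pos (by linarith)
  have hR0 : 0 < R := Real.rpow_pos_of_pos hT0 _
  have hy0 : 0 < y := Real.rpow_pos_of_pos hT0 _
  have hR3 : 3 ≤ R := by
    rw [← Real.log_le_log_iff (by norm_num) hR0, hlogR]
    linarith
  have hRy : R ≤ y := Real.rpow_le_rpow_of_exponent_le (by linarith) (by norm_num)
  have hy1 : 1 < y := by linarith
  have hS := isSieveSupport_sieveSupport hD14 R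
  have hM : ∀ j, 0 ≤ sieveMoment D R j := fun j => sum_nonneg fun r hr => by
    have h1 := hS.weight_pos hr
    have h2 := log_div_nonneg_of_mem_sieveSupport hr
    positivity
  have hM0 : 0 < sieveMoment D R 0 :=
    zero_lt_one.trans_le (one_le_sieveMoment_zero hD14 (by linarith))
  obtain ⟨h4, h5⟩ := h₁ D hD14 R
  have h6 := h₂ F D hF hD R y (by linarith) hRy (by rw [hlogR, hlogy]; ring) T
  have h7 := h₃ D hD14 R hR3
  have h8 := sieveError_le hD (show 1 ≤ R by linarith)
  set L := Real.log R with hL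
  set M₀ := sieveMoment D R 0
  set M₁ := sieveMoment D R 1
  set M₂ := sieveMoment D R 2
  have hL0 : 0 < L := by rw [hlogR]; positivity
  have hLx : L ≤ Real.log x := by rw [hlogR]; linarith
  have hLC1 : 10 * C₁ ≤ L := by rw [hlogR]; linarith
  have hLC2 : 80 * C₂ ≤ L := by rw [hlogR]; linarith
  have h9 : L * M₀ ≤ 9 * M₁ := by
    have h10 := mul_le_mul_of_nonneg_right hLC1 hM0.le
    have h11 := mul_nonneg (by linarith : (0 : ℝ) ≤ C₁) hM0.le
    nlinarith
  have h10 : L * M₁ ≤ 5 * M₂ := by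
    have h10 := mul_le_mul_of_nonneg_right hLC1 (hM 1)
    linarith
  have h11 : C₂ * M₁ ≤ M₂ / 16 := by
    have h12 := mul_le_mul_of_nonneg_right hLC2 (hM 1)
    linarith
  have h12 : L ^ 2 * M₀ / 45 ≤ M₂ := by
    have h13 := mul_le_mul_of_nonneg_left h9 hL0.le
    linarith [show L ^ 2 * M₀ = L * (L * M₀) by ring, show L * (9 * M₁) = 9 * (L * M₁) by ring]
  have h13 : 172800 * M₀ ≤ x ^ (1 / 36 : ℝ) := by
    refine le_trans ?_ hT4
    have : L ^ 7 ≤ Real.log x ^ 7 := by gcongr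
    have h14 : C₃ * L ^ 7 ≤ C₃ * Real.log x ^ 7 := by gcongr
    linarith
  have h14 : 120 * y * sieveError D R ≤ x * (L ^ 2 * M₀ / 1440) := by
    have e1 : R ^ (17 / 8 : ℝ) = x ^ (17 / 36 : ℝ) := by
      rw [hR, ← Real.rpow_mul hT0.le]
      norm_num
    have e2 : y * x ^ (17 / 36 : ℝ) * x ^ (1 / 36 : ℝ) = x := by
      rw [hy, ← Real.rpow_add hT0, ← Real.rpow_add hT0]
      norm_num
    have h15 : 0 ≤ y * x ^ (17 / 36 : ℝ) := by positivity
    calc 120 * y * sieveError D R ≤ 120 * y * ((L * M₀) ^ 2 * x ^ (17 / 36 : ℝ)) := by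
          rw [← e1]
          gcongr
      _ = (y * x ^ (17 / 36 : ℝ)) * (L ^ 2 * M₀ / 1440) * (172800 * M₀) := by ring
      _ ≤ (y * x ^ (17 / 36 : ℝ)) * (L ^ 2 * M₀ / 1440) * x ^ (1 / 36 : ℝ) := by gcongr
      _ = (y * x ^ (17 / 36 : ℝ) * x ^ (1 / 36 : ℝ)) * (L ^ 2 * M₀ / 1440) := by ring
      _ = _ := by rw [e2]
  have h15 : x * (L ^ 2 * M₀ / 720) ≤ x * (M₂ / 8 - C₂ * M₁) := by
    gcongr
    linarith
  have h16 := sum_sieveSum_sq_mul_le hF hD14 R hy1 (T := T) fun t ht => by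
    obtain ⟨ht1, ht2⟩ := mem_Ico.1 ht
    have ht0 := hTt.trans ht1
    refine ⟨hpos t ht0, ?_⟩
    have hF0 : (0 : ℝ) < F t := by exact_mod_cast Nat.pos_of_ne_zero (hpos t ht0)
    have ht3 : (t : ℝ) ≤ 2 * x := by
      rw [hx]
      exact_mod_cast ht2.le
    have h17 : (F t : ℝ) ≤ K * (2 * x) ^ 7 := (hle t ht0).trans (by gcongr)
    refine (Real.log_le_log hF0 h17).trans ?_
    rw [Real.log_mul (by positivity) (by positivity), Real.log_pow,
      Real.log_mul (by positivity) (by positivity), hlogy]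
    push_cast
    linarith
  set G := (Ico T (2 * T)).filter fun t => (F t).primeFactors.card ≤ 27 ∧
        ∀ p ∈ sievePrimes D y, ¬ p ^ 2 ∣ F t with hG
  have h17 : x * (L ^ 2 * M₀ / 1440) ≤ G.card * (14 * (2 ^ 54 * (L * M₀)) ^ 2) := by
    linarith
  have h18 : x ≤ G.card * (20160 * 2 ^ 108 * M₀) := by
    have h19 : 0 < L ^ 2 * M₀ / 1440 := by positivity
    refine le_of_mul_le_mul_right ?_ h19
    refine h17.trans (le_of_eq ?_)
    ring
  have h19 : M₀ ≤ C₃ * Real.log x ^ 7 := h7.trans (by gcongr)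
  rw [div_le_iff₀ (by positivity), div_mul_eq_mul_div, one_mul, div_le_iff₀ (by positivity)]
  calc x ≤ G.card * (20160 * 2 ^ 108 * M₀) := h18
    _ ≤ G.card * (20160 * 2 ^ 108 * (C₃ * Real.log x ^ 7)) := by gcongr
    _ = _ := by ring

theorem exists_le_card (hF : IsSieveSequence F D) (hD : 14 ^ 16 ≤ D) {K : ℝ}
    (hK : 1 ≤ K) {t₀ : ℕ} (hpos : ∀ t, t₀ ≤ t → F t ≠ 0)
    (hle : ∀ t, t₀ ≤ t → (F t : ℝ) ≤ K * (t : ℝ) ^ 7)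
    (hsq : ∀ t, t₀ ≤ t → ∀ p : ℕ, p.Prime → D < p → p ^ 2 ∣ F t → (p : ℝ) ^ 2 ≤ K * t) :
    ∃ c : ℝ, 0 < c ∧ ∀ᶠ T : ℕ in Filter.atTop, c * T / Real.log T ^ 7 ≤
      ((Ico T (2 * T)).filter fun t => (F t).primeFactorsList.length ≤ 27).card := by
  obtain ⟨c, hc, h⟩ := hF.exists_le_card_primeFactors hD hK hpos hle
  refine ⟨c / 2, by positivity, ?_⟩
  filter_upwards [h, Filter.eventually_ge_atTop (max t₀ 2),
    eventually_mul_log_pow_le_rpow ((14 + 14 * K) / (c / 2)) (show (0 : ℝ) < 1 / 2 by norm_num)]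
    with T h hT hT1
  have hTt : t₀ ≤ T := (le_max_left _ _).trans hT
  have hT2 : (2 : ℝ) ≤ T := by exact_mod_cast (le_max_right _ _).trans hT
  have hT0 : (0 : ℝ) < T := by linarith
  have hlx : 0 < Real.log T := Real.log_pos (by linarith)
  set y : ℝ := (T : ℝ) ^ (1 / 2 : ℝ) with hy
  have hyy : y * y = T := by
    rw [hy, ← Real.rpow_add hT0]
    norm_num
  have hy1 : 1 < y := Real.one_lt_rpow (by linarith) (by norm_num)
  set k := ⌊y⌋₊ with hk
  set N := ⌊2 * K * y⌋₊ with hN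
  have hk0 : 0 < k := Nat.floor_pos.2 hy1.le
  have hk2 : y ≤ 2 * k := by
    have h1 := Nat.lt_floor_add_one y
    have h2 : (1 : ℝ) ≤ k := by exact_mod_cast hk0
    linarith
  have hbad := hF.card_sq_dvd_le hk0 N T
  set B := (Ico T (2 * T)).filter fun t => ∃ p ∈ Ioc k N, p.Prime ∧ D < p ∧ p ^ 2 ∣ F t
  set G := (Ico T (2 * T)).filter fun t => (F t).primeFactors.card ≤ 27 ∧
        ∀ p ∈ sievePrimes D y, ¬ p ^ 2 ∣ F t
  set A := (Ico T (2 * T)).filter fun t => (F t).primeFactorsList.length ≤ 27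
  have hsub : G ⊆ A ∪ B := fun t ht => by
    obtain ⟨ht, h1, h2⟩ := mem_filter.1 ht
    by_cases hb : t ∈ B
    · exact mem_union_right _ hb
    refine mem_union_left _ (mem_filter.2 ⟨ht, ?_⟩)
    obtain ⟨ht1, ht2⟩ := mem_Ico.1 ht
    have hsf : Squarefree (F t) := by
      rw [Nat.squarefree_iff_prime_squarefree]
      intro p hp hpd
      rw [← sq] at hpd
      have hpD : D < p := not_le.1 fun h3 =>
        hF.not_dvd p hp h3 t ((dvd_pow_self p two_ne_zero).trans hpd)
      by_cases hpk : p ≤ k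
      · exact h2 p (mem_sievePrimes.2 ⟨⟨hp.one_lt, hpk⟩, hp, hpD⟩) hpd
      · refine hb (mem_filter.2 ⟨ht, p, mem_Ioc.2 ⟨not_le.1 hpk, Nat.le_floor ?_⟩, hp, hpD, hpd⟩)
        have h3 := hsq t (hTt.trans ht1) p hp hpD hpd
        have h4 : (t : ℝ) ≤ 2 * T := by exact_mod_cast ht2.le
        refine abs_le_of_sq_le_sq' ?_ (by positivity) |>.2
        calc (p : ℝ) ^ 2 ≤ K * t := h3
          _ ≤ K * (2 * T) := by gcongr
          _ ≤ (2 * K * y) ^ 2 := by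
            rw [mul_pow, sq y, hyy]
            nlinarith [mul_nonneg (mul_nonneg (by linarith : (0 : ℝ) ≤ K) hT0.le)
              (sub_nonneg.2 hK)]
    rw [← List.toFinset_card_of_nodup
      ((Nat.squarefree_iff_nodup_primeFactorsList hsf.ne_zero).1 hsf)]
    exact h1
  have h1 : (G.card : ℝ) ≤ A.card + B.card := by
    exact_mod_cast (card_le_card hsub).trans (card_union_le _ _)
  have h2 : 7 * (T : ℝ) / k + 7 * N ≤ (14 + 14 * K) * y := by
    have h3 : (N : ℝ) ≤ 2 * K * y := Nat.floor_le (by positivity)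
    have h4 : 7 * (T : ℝ) / k ≤ 14 * y := by
      rw [div_le_iff₀ (by exact_mod_cast hk0), ← hyy]
      nlinarith
    linarith
  have h3 : (14 + 14 * K) * y ≤ c / 2 * T / Real.log T ^ 7 := by
    rw [div_mul_eq_mul_div, div_le_iff₀ (by positivity)] at hT1
    rw [le_div_iff₀ (by positivity)]
    calc (14 + 14 * K) * y * Real.log T ^ 7 = ((14 + 14 * K) * Real.log T ^ 7) * y := by ring
      _ ≤ y * (c / 2) * y := by gcongr
      _ = c / 2 * (y * y) := by ring
      _ = _ := by rw [hyy]
  have h4 : c * T / Real.log T ^ 7 = c / 2 * T / Real.log T ^ 7 + c / 2 * T / Real.log T ^ 7 := by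
    ring
  linarith

end IsSieveSequence

lemma prime_pow_dvd_prod_iff {p : ℕ} (hp : p.Prime) {α β : Fin 7 → ℤ}
    (hdet : ∀ i j, i ≠ j → ¬ (p : ℤ) ∣ α i * β j - α j * β i) {k : ℕ} (hk : k ≠ 0) (t : ℤ) :
    (p : ℤ) ^ k ∣ ∏ i, (α i * t + β i) ↔ ∃ i, (p : ℤ) ^ k ∣ α i * t + β i := by
  have hp' : Prime (p : ℤ) := Nat.prime_iff_prime_int.1 hp
  refine ⟨fun h => ?_, fun ⟨i, hi⟩ => hi.trans (dvd_prod_of_mem _ (mem_univ i))⟩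
  obtain ⟨i, -, hi⟩ := (hp'.dvd_finsetProd_iff _).1 ((dvd_pow_self _ hk).trans h)
  refine ⟨i, ?_⟩
  rw [← mul_prod_erase univ _ (mem_univ i)] at h
  refine IsCoprime.dvd_of_dvd_mul_right (IsCoprime.pow_left ?_) h
  refine IsCoprime.prod_right fun j hj => (hp'.coprime_iff_not_dvd).2 fun hdvd => ?_
  refine hdet i j (ne_of_mem_erase hj).symm ?_
  have := (hdvd.mul_left (α i)).sub (hi.mul_left (α j))
  ring_nf at this ⊢
  exact this

/-- The zeros of a product of seven linear forms in a commutative ring. -/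
def formZeros (α β : Fin 7 → ℤ) (R : Type*) [CommRing R] : Type _ :=
  {x : R // ∏ i, ((α i : R) * x + β i) = 0}

lemma card_formZeros_congr (α β : Fin 7 → ℤ) {R S : Type*} [CommRing R] [CommRing S]
    (e : R ≃+* S) : Nat.card (formZeros α β R) = Nat.card (formZeros α β S) := by
  refine Nat.card_congr (e.toEquiv.subtypeEquiv fun x => ?_)
  rw [← map_eq_zero_iff e e.injective, map_prod]
  simp

lemma card_formZeros_prod (α β : Fin 7 → ℤ) (R S : Type*) [CommRing R] [CommRing S] :
    Nat.card (formZeros α β (R × S)) =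
      Nat.card (formZeros α β R) * Nat.card (formZeros α β S) := by
  rw [← Nat.card_prod]
  refine Nat.card_congr ((Equiv.subtypeEquivRight fun x => ?_).trans
    (Equiv.subtypeProdEquivProd (p := fun x : R => ∏ i, ((α i : R) * x + β i) = 0)
      (q := fun x : S => ∏ i, ((α i : S) * x + β i) = 0)))
  rw [Prod.ext_iff, Prod.fst_prod, Prod.snd_prod]
  simp

lemma card_formZeros_prime_pow {p : ℕ} (hp : p.Prime) {α β : Fin 7 → ℤ}
    (hα : ∀ i, ¬ (p : ℤ) ∣ α i)
    (hdet : ∀ i j, i ≠ j → ¬ (p : ℤ) ∣ α i * β j - α j * β i) {k : ℕ} (hk : k ≠ 0) :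
    Nat.card (formZeros α β (ZMod (p ^ k))) = 7 := by
  have hp' : Prime (p : ℤ) := Nat.prime_iff_prime_int.1 hp
  have hunit : ∀ a : ℤ, ¬ (p : ℤ) ∣ a → IsUnit (a : ZMod (p ^ k)) := fun a ha => by
    rw [ZMod.coe_int_isUnit_iff_isCoprime]
    push_cast
    exact ((hp'.coprime_iff_not_dvd).2 ha).pow_left
  choose u hu using fun i => hunit (α i) (hα i)
  have hroot : ∀ i (x : ZMod (p ^ k)),
      (α i : ZMod (p ^ k)) * x + β i = 0 ↔ x = -(↑(u i)⁻¹ * β i) := fun i x => by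
    rw [← hu i]
    constructor
    · intro h
      linear_combination (↑(u i)⁻¹ : ZMod (p ^ k)) * h - x * (u i).inv_mul
    · rintro rfl
      simp
  have hinj : Function.Injective fun i => -((↑(u i)⁻¹ : ZMod (p ^ k)) * β i) := fun i j hij => by
    by_contra hne
    have h1 := (hroot i _).2 rfl
    have h2 := (hroot j _).2 hij
    have h3 : ((α i * β j - α j * β i : ℤ) : ZMod (p ^ k)) = 0 := by
      push_cast
      linear_combination (α i : ZMod (p ^ k)) * h2 - (α j : ZMod (p ^ k)) * h1
    rw [ZMod.intCast_zmod_eq_zero_iff_dvd] at h3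
    push_cast at h3
    exact hdet i j hne ((dvd_pow_self _ hk).trans h3)
  refine (Nat.subtype_card (univ.image fun i => -((↑(u i)⁻¹ : ZMod (p ^ k)) * β i))
    fun x => ?_).trans (by rw [card_image_of_injective _ hinj]; rfl)
  obtain ⟨t, rfl⟩ := ZMod.intCast_surjective x
  have h1 := prime_pow_dvd_prod_iff hp hdet hk t
  have h2 : ∀ a : ℤ, (p : ℤ) ^ k ∣ a ↔ (a : ZMod (p ^ k)) = 0 := fun a => by
    rw [ZMod.intCast_zmod_eq_zero_iff_dvd]
    push_cast
    rfl
  simp only [h2] at h1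
  push_cast at h1
  rw [h1, mem_image]
  simp only [hroot, mem_univ, true_and, eq_comm]

lemma card_formZeros {α β : Fin 7 → ℤ} {D : ℕ}
    (hα : ∀ p : ℕ, p.Prime → D < p → ∀ i, ¬ (p : ℤ) ∣ α i)
    (hdet : ∀ p : ℕ, p.Prime → D < p → ∀ i j, i ≠ j → ¬ (p : ℤ) ∣ α i * β j - α j * β i)
    {m : ℕ} (hm : m ≠ 0) (hmD : ∀ p : ℕ, p.Prime → p ∣ m → D < p) :
    Nat.card (formZeros α β (ZMod m)) = 7 ^ m.primeFactors.card := by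
  induction m using Nat.recOnPosPrimePosCoprime with
  | zero => exact absurd rfl hm
  | one =>
    have : Subsingleton (ZMod 1) := inferInstanceAs (Subsingleton (Fin 1))
    rw [Nat.primeFactors_one, card_empty, pow_zero]
    exact (Nat.subtype_card univ fun x => by simp [eq_iff_true_of_subsingleton]).trans rfl
  | prime_pow p n hp hn =>
    have hD := hmD p hp (dvd_pow_self p hn.ne')
    rw [card_formZeros_prime_pow hp (hα p hp hD) (hdet p hp hD) hn.ne',
      Nat.primeFactors_prime_pow hn.ne' hp, card_singleton, pow_one]
  | coprime a b ha hb hab iha ihb =>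
    rw [card_formZeros_congr α β (ZMod.chineseRemainder hab), card_formZeros_prod,
      iha (by omega) fun p hp h => hmD p hp (h.mul_right b),
      ihb (by omega) fun p hp h => hmD p hp (h.mul_left a), hab.primeFactors_mul,
      card_union_of_disjoint hab.disjoint_primeFactors, pow_add]

lemma card_filter_range_dvd_eq (α β : Fin 7 → ℤ) {m : ℕ} (hm : m ≠ 0) :
    ((range m).filter fun t : ℕ => m ∣ (∏ i, (α i * t + β i)).natAbs).card =
      Nat.card (formZeros α β (ZMod m)) := by
  have : NeZero m := ⟨hm⟩
  symm
  refine (Nat.subtype_card (((range m).filter fun t : ℕ =>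
    m ∣ (∏ i, (α i * t + β i)).natAbs).image (Nat.cast : ℕ → ZMod m)) fun x => ?_).trans
    (card_image_of_injOn ?_)
  · have h : ∀ t : ℕ, m ∣ (∏ i, (α i * t + β i)).natAbs ↔
        ∏ i, ((α i : ZMod m) * (t : ZMod m) + β i) = 0 := fun t => by
      rw [← Int.natCast_dvd, ← ZMod.intCast_zmod_eq_zero_iff_dvd]
      push_cast
      rfl
    simp only [mem_image, mem_filter, mem_range, h]
    constructor
    · rintro ⟨t, ⟨-, ht⟩, rfl⟩
      exact ht
    · intro hx
      refine ⟨x.val, ⟨x.val_lt, ?_⟩, ?_⟩ <;> simp [hx]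
  · intro s hs t ht hst
    rw [mem_coe, mem_filter, mem_range] at hs ht
    exact Nat.ModEq.eq_of_lt_of_lt ((ZMod.natCast_eq_natCast_iff s t m).1 hst) hs.1 ht.1

lemma abs_card_filter_Ico_sub_le {p : ℕ → Prop} [DecidablePred p] {m : ℕ} (hm : m ≠ 0)
    (hp : Function.Periodic p m) (a T : ℕ) :
    |(((Ico a (a + T)).filter p).card : ℝ) - T * (((range m).filter p).card / m)| ≤
      ((range m).filter p).card := by
  set c := ((range m).filter p).card with hc
  have hper : ∀ n, ((Ico n (n + m)).filter p).card = c := fun n => by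
    rw [Nat.filter_Ico_card_eq_of_periodic _ _ _ hp, Nat.count_eq_card_filter_range]
  have hadd : ∀ n r s, ((Ico n (n + r + s)).filter p).card =
      ((Ico n (n + r)).filter p).card + ((Ico (n + r) (n + r + s)).filter p).card :=
    fun n r s => by
      rw [← Ico_union_Ico_eq_Ico (Nat.le_add_right n r) (Nat.le_add_right (n + r) s),
        filter_union, card_union_of_disjoint
          (disjoint_filter_filter (Ico_disjoint_Ico_consecutive _ _ _))]
  have hmul : ∀ q, ((Ico a (a + q * m)).filter p).card = q * c := fun q => by
    induction q with
    | zero => simp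
    | succ q ih => rw [Nat.succ_mul, ← add_assoc, hadd, ih, hper, Nat.succ_mul]
  obtain ⟨q, r, hr, rfl⟩ : ∃ q r, r < m ∧ T = q * m + r :=
    ⟨T / m, T % m, Nat.mod_lt _ (Nat.pos_of_ne_zero hm), (Nat.div_add_mod' T m).symm⟩
  have h1 : ((Ico (a + q * m) (a + q * m + r)).filter p).card ≤ c := by
    rw [← hper (a + q * m)]
    exact card_le_card (filter_subset_filter _ (Ico_subset_Ico_right (by omega)))
  have h2 : ((Ico a (a + (q * m + r))).filter p).card =
      q * c + ((Ico (a + q * m) (a + q * m + r)).filter p).card := by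
    rw [← add_assoc, hadd, hmul]
  have hm0 : (0 : ℝ) < m := by exact_mod_cast Nat.pos_of_ne_zero hm
  have h3 : ((q * m + r : ℕ) : ℝ) * (c / m) = q * c + r / m * c := by
    push_cast
    field_simp
  have h4 : (r : ℝ) / m * c ≤ c := by
    refine mul_le_of_le_one_left (by positivity) ((div_le_one hm0).2 ?_)
    exact_mod_cast hr.le
  have h5 : (0 : ℝ) ≤ (r : ℝ) / m * c := by positivity
  rw [h2, h3, abs_le]
  have h6 : (((Ico (a + q * m) (a + q * m + r)).filter p).card : ℝ) ≤ c := by exact_mod_cast h1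
  have h7 : (0 : ℝ) ≤ (((Ico (a + q * m) (a + q * m + r)).filter p).card : ℝ) := by positivity
  push_cast
  constructor <;> linarith

lemma isSieveSequence_prod {α β : Fin 7 → ℤ} {D : ℕ}
    (hα : ∀ p : ℕ, p.Prime → D < p → ∀ i, ¬ (p : ℤ) ∣ α i)
    (hdet : ∀ p : ℕ, p.Prime → D < p → ∀ i j, i ≠ j → ¬ (p : ℤ) ∣ α i * β j - α j * β i)
    (hnot : ∀ p : ℕ, p.Prime → p ≤ D → ∀ t : ℕ, ¬ (p : ℤ) ∣ ∏ i, (α i * t + β i)) :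
    IsSieveSequence (fun t => (∏ i, (α i * t + β i)).natAbs) D where
  not_dvd p hp hpD t h := hnot p hp hpD t (Int.natCast_dvd.2 h)
  count m hm hmD T := by
    have hper : Function.Periodic (fun t : ℕ => m ∣ (∏ i, (α i * t + β i)).natAbs) m :=
      fun t => by
        have h : ∀ t : ℕ, m ∣ (∏ i, (α i * t + β i)).natAbs ↔
            ∏ i, ((α i : ZMod m) * (t : ZMod m) + β i) = 0 := fun t => by
          rw [← Int.natCast_dvd, ← ZMod.intCast_zmod_eq_zero_iff_dvd]
          push_cast
          rfl
        simp only [h]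
        simp
    have h := abs_card_filter_Ico_sub_le hm hper T T
    rw [card_filter_range_dvd_eq α β hm, card_formZeros hα hdet hm hmD, ← two_mul] at h
    exact_mod_cast h

lemma exists_le_card_prod_forms {α β : Fin 7 → ℤ} {D : ℕ} (hD : 14 ^ 16 ≤ D)
    (hα1 : ∀ i, 1 ≤ α i)
    (hα : ∀ p : ℕ, p.Prime → D < p → ∀ i, ¬ (p : ℤ) ∣ α i)
    (hdet : ∀ p : ℕ, p.Prime → D < p → ∀ i j, i ≠ j → ¬ (p : ℤ) ∣ α i * β j - α j * β i)
    (hnot : ∀ p : ℕ, p.Prime → p ≤ D → ∀ t : ℕ, ¬ (p : ℤ) ∣ ∏ i, (α i * t + β i)) :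
    ∃ c : ℝ, 0 < c ∧ ∀ᶠ T : ℕ in Filter.atTop, c * T / Real.log T ^ 7 ≤
      ((Ico T (2 * T)).filter fun t : ℕ => 0 < ∏ i, (α i * t + β i) ∧
        (∏ i, (α i * t + β i)).natAbs.primeFactorsList.length ≤ 27).card := by
  have hF := isSieveSequence_prod hα hdet hnot
  set B : ℕ := 1 + ∑ i, ((α i).natAbs + (β i).natAbs) with hB
  have hαβ : ∀ i, (α i).natAbs + (β i).natAbs < B := fun i => by
    have := single_le_sum (f := fun i => (α i).natAbs + (β i).natAbs)
      (fun _ _ => Nat.zero_le _) (mem_univ i)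
    omega
  have hpos : ∀ t : ℕ, B ≤ t → ∀ i, 0 < α i * t + β i := fun t ht i => by
    have h1 := hαβ i
    have h2 : (t : ℤ) ≤ α i * t := le_mul_of_one_le_left (by positivity) (hα1 i)
    omega
  have hle : ∀ t : ℕ, B ≤ t → ∀ i, ((α i * t + β i).natAbs : ℝ) ≤ B * t := fun t ht i => by
    have h1 : (α i * t + β i).natAbs ≤ (α i).natAbs * t + (β i).natAbs := by
      simpa [Int.natAbs_mul] using Int.natAbs_add_le (α i * t) (β i)
    have h2 : (β i).natAbs ≤ (β i).natAbs * t := Nat.le_mul_of_pos_right _ (by omega)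
    have h3 : ((α i).natAbs + (β i).natAbs) * t ≤ B * t := Nat.mul_le_mul_right _ (hαβ i).le
    rw [add_mul] at h3
    exact_mod_cast h1.trans ((Nat.add_le_add_left h2 _).trans h3)
  have hB1 : (1 : ℝ) ≤ B := by
    rw [hB]
    push_cast
    exact le_add_of_nonneg_right (by positivity)
  have hprod : ∀ t : ℕ, B ≤ t → 0 < ∏ i, (α i * t + β i) := fun t ht =>
    prod_pos fun i _ => hpos t ht i
  have hle' : ∀ t : ℕ, B ≤ t →
      ((∏ i, (α i * t + β i)).natAbs : ℝ) ≤ (B : ℝ) ^ 7 * (t : ℝ) ^ 7 := fun t ht => by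
    rw [← Int.natAbsHom_apply, map_prod, Nat.cast_prod, ← mul_pow]
    refine (prod_le_prod (fun _ _ => by positivity) fun i _ => hle t ht i).trans ?_
    simp
  have hsq : ∀ t : ℕ, B ≤ t → ∀ p : ℕ, p.Prime → D < p →
      p ^ 2 ∣ (∏ i, (α i * t + β i)).natAbs → (p : ℝ) ^ 2 ≤ (B : ℝ) ^ 7 * t :=
    fun t ht p hp hpD hdvd => by
      rw [← Int.natCast_dvd] at hdvd
      push_cast at hdvd
      obtain ⟨i, hi⟩ := (prime_pow_dvd_prod_iff hp (hdet p hp hpD) two_ne_zero t).1 hdvd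
      have h1 : p ^ 2 ≤ (α i * t + β i).natAbs :=
        Nat.le_of_dvd (Int.natAbs_pos.2 (hpos t ht i).ne')
          (Int.natCast_dvd.1 (by exact_mod_cast hi))
      calc (p : ℝ) ^ 2 ≤ (α i * t + β i).natAbs := by exact_mod_cast h1
        _ ≤ B * t := hle t ht i
        _ ≤ (B : ℝ) ^ 7 * t := by
          gcongr
          exact le_self_pow₀ hB1 (by norm_num)
  obtain ⟨c, hc, h⟩ := hF.exists_le_card hD (one_le_pow₀ hB1)
    (fun t ht => Int.natAbs_ne_zero.2 (hprod t ht).ne') hle' hsq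
  refine ⟨c, hc, ?_⟩
  filter_upwards [h, Filter.eventually_ge_atTop B] with T hT hBT
  refine hT.trans (Nat.cast_le.2 (card_le_card fun t ht => ?_))
  obtain ⟨ht1, ht2⟩ := mem_filter.1 ht
  exact mem_filter.2 ⟨ht1, hprod t (hBT.trans (mem_Ico.1 ht1).1), ht2⟩

lemma exists_forall_not_dvd_prod {a b : Fin 7 → ℤ}
    (h : ∀ p : ℕ, p.Prime → ∃ n : ℕ, 0 < n ∧ ¬ (p : ℤ) ∣ ∏ i, (a i * n + b i)) (D : ℕ) :
    ∃ n : ℕ, ∀ p : ℕ, p.Prime → p ≤ D → ∀ m : ℕ, m ≡ n [MOD p] →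
      ¬ (p : ℤ) ∣ ∏ i, (a i * m + b i) := by
  choose! f _ hf using h
  obtain ⟨n, hn⟩ := Nat.chineseRemainderOfFinset f id ((range (D + 1)).filter Nat.Prime)
    (fun p hp => (mem_filter.1 hp).2.ne_zero) fun p hp q hq hpq =>
      (Nat.coprime_primes (mem_filter.1 hp).2 (mem_filter.1 hq).2).2 hpq
  refine ⟨n, fun p hp hpD m hm hdvd => hf p hp ?_⟩
  have h1 : (m : ZMod p) = f p := (ZMod.natCast_eq_natCast_iff _ _ _).2
    (hm.trans (hn p (mem_filter.2 ⟨mem_range.2 (by omega), hp⟩)))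
  rw [← ZMod.intCast_zmod_eq_zero_iff_dvd] at hdvd ⊢
  push_cast at hdvd ⊢
  rwa [← h1]

lemma not_dvd_of_natAbs_lt {p : ℕ} {z : ℤ} (hz : z ≠ 0) (h : z.natAbs < p) :
    ¬ (p : ℤ) ∣ z := fun hd =>
  h.not_ge (Nat.le_of_dvd (Int.natAbs_pos.2 hz) (Int.natCast_dvd.1 hd))

lemma exists_le_card_of_progression {P : ℕ → Prop} [DecidablePred P] {n₀ W : ℕ} (hW : 0 < W)
    {c : ℝ} (hc : 0 < c) (h : ∀ᶠ T : ℕ in Filter.atTop, c * T / Real.log T ^ 7 ≤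
      ((Ico T (2 * T)).filter fun t => P (n₀ + W * t)).card) :
    ∃ δ : ℝ, 0 < δ ∧ ∃ x₀ : ℝ, ∀ x : ℝ, x₀ ≤ x →
      δ * x / (Real.log x) ^ 7 ≤ (((Icc 1 ⌊x⌋₊).filter P).card : ℝ) := by
  obtain ⟨T₀, hT₀⟩ := Filter.eventually_atTop.1 h
  have hW1 : (1 : ℝ) ≤ W := by exact_mod_cast hW
  refine ⟨c / (4 * W), by positivity, 2 * n₀ + 4 * W * (T₀ + 2), fun x hx => ?_⟩
  set T := ⌊(x - n₀) / (2 * W)⌋₊ with hT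
  have hn₀ : (0 : ℝ) ≤ n₀ := by positivity
  have hWT : (0 : ℝ) ≤ 4 * W * T₀ := by positivity
  have h1 : x / (4 * W) ≤ T := by
    have h2 := (Nat.lt_floor_add_one ((x - n₀) / (2 * W))).le
    rw [← hT, div_le_iff₀ (by positivity)] at h2
    rw [div_le_iff₀ (by positivity)]
    nlinarith
  have h2 : (T₀ : ℝ) + 2 ≤ T := by
    refine le_trans ?_ h1
    rw [le_div_iff₀ (by positivity)]
    linarith
  have h3 : n₀ + W * (2 * T) ≤ x := by
    have h4 := Nat.floor_le (show 0 ≤ (x - n₀) / (2 * W) from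
      div_nonneg (by nlinarith) (by positivity))
    rw [← hT, le_div_iff₀ (by positivity)] at h4
    linarith
  have hT2 : (2 : ℝ) ≤ T := by linarith [(Nat.cast_nonneg T₀ : (0 : ℝ) ≤ T₀)]
  have h4 : (T : ℝ) ≤ x := by nlinarith
  have hlog : 0 < Real.log T := Real.log_pos (by linarith)
  have hlog' : Real.log T ≤ Real.log x := Real.log_le_log (by linarith) h4
  have hcard : ((Ico T (2 * T)).filter fun t => P (n₀ + W * t)).card ≤
      ((Icc 1 ⌊x⌋₊).filter P).card := by
    refine card_le_card_of_injOn (fun t => n₀ + W * t) (fun t ht => ?_) fun s _ t _ hst => ?_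
    · obtain ⟨ht, hP⟩ := mem_filter.1 ht
      obtain ⟨ht1, ht2⟩ := mem_Ico.1 ht
      have hT2' : 2 ≤ T := by exact_mod_cast hT2
      have h5 : 0 < W * t := Nat.mul_pos hW (by omega)
      refine mem_filter.2 ⟨mem_Icc.2 ⟨Nat.add_pos_right _ h5, Nat.le_floor (le_trans ?_ h3)⟩, hP⟩
      exact_mod_cast Nat.add_le_add_left (Nat.mul_le_mul_left W ht2.le) n₀
    · exact Nat.eq_of_mul_eq_mul_left hW (Nat.add_left_cancel hst)
  calc c / (4 * W) * x / Real.log x ^ 7 = c * (x / (4 * W)) / Real.log x ^ 7 := by ring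
    _ ≤ c * T / Real.log T ^ 7 := by gcongr
    _ ≤ _ := hT₀ T (by exact_mod_cast (show (T₀ : ℝ) ≤ T by linarith))
    _ ≤ _ := by exact_mod_cast hcard

end

theorem seven_dim_sieve
    (a b : Fin 7 → ℤ) (ha : ∀ i, 1 ≤ a i)
    (hnz : (∏ i, a i) *
        (∏ ts ∈ Finset.univ.filter (fun ts : Fin 7 × Fin 7 => ts.1 < ts.2),
          (a ts.1 * b ts.2 - a ts.2 * b ts.1)) ≠ 0)
    (hnofixed : ∀ p : ℕ, p.Prime →
      ∃ n : ℕ, 0 < n ∧ ¬ (p : ℤ) ∣ ∏ i, (a i * n + b i)) :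
    ∃ δ : ℝ, 0 < δ ∧ ∃ x₀ : ℝ, ∀ x : ℝ, x₀ ≤ x →
      δ * x / (Real.log x) ^ 7 ≤
        (((Finset.Icc 1 ⌊x⌋₊).filter fun n : ℕ =>
            0 < ∏ i, (a i * n + b i) ∧
            (∏ i, (a i * n + b i)).natAbs.primeFactorsList.length ≤ 27).card : ℝ) := by
  have hdet : ∀ i j, i ≠ j → a i * b j - a j * b i ≠ 0 := by
    have hlt : ∀ i j, i < j → a i * b j - a j * b i ≠ 0 := fun i j hij =>
      Finset.prod_ne_zero_iff.1 (right_ne_zero_of_mul hnz) (i, j)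
        (Finset.mem_filter.2 ⟨Finset.mem_univ _, hij⟩)
    intro i j hij
    rcases lt_or_gt_of_ne hij with h | h
    · exact hlt i j h
    · rw [← neg_sub]
      exact neg_ne_zero.2 (hlt j i h)
  obtain ⟨D, hD, hDa, hDdet⟩ : ∃ D : ℕ, 14 ^ 16 ≤ D ∧ (∀ i, (a i).natAbs ≤ D) ∧
      ∀ i j, (a i * b j - a j * b i).natAbs ≤ D := by
    refine ⟨14 ^ 16 + Finset.univ.sup (fun i => (a i).natAbs) +
      Finset.univ.sup fun ij : Fin 7 × Fin 7 =>
        (a ij.1 * b ij.2 - a ij.2 * b ij.1).natAbs, by omega, fun i => ?_, fun i j => ?_⟩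
    · have := Finset.le_sup (f := fun i => (a i).natAbs) (Finset.mem_univ i)
      omega
    · exact (Finset.le_sup (f := fun ij : Fin 7 × Fin 7 =>
        (a ij.1 * b ij.2 - a ij.2 * b ij.1).natAbs) (Finset.mem_univ (i, j))).trans
        (Nat.le_add_left _ _)
  obtain ⟨n₀, hn₀⟩ := exists_forall_not_dvd_prod hnofixed D
  have hW : 0 < primorial D := primorial_pos D
  have hpW : ∀ p : ℕ, p.Prime → D < p → ¬ (p : ℤ) ∣ primorial D := fun p hp hpD h =>
    hpD.not_ge (hp.dvd_primorial_iff.1 (by exact_mod_cast h))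
  have hform : ∀ t : ℕ, ∏ i, (a i * ((n₀ + primorial D * t : ℕ) : ℤ) + b i) =
      ∏ i, (a i * primorial D * t + (a i * n₀ + b i)) := fun t =>
    Finset.prod_congr rfl fun i _ => by push_cast; ring
  obtain ⟨c, hc, h⟩ := exists_le_card_prod_forms (α := fun i => a i * primorial D)
    (β := fun i => a i * n₀ + b i) hD
    (fun i => one_le_mul_of_one_le_of_one_le (ha i) (by exact_mod_cast hW))
    (fun p hp hpD i => (Nat.prime_iff_prime_int.1 hp).not_dvd_mul
      (not_dvd_of_natAbs_lt (by have := ha i; omega) ((hDa i).trans_lt hpD)) (hpW p hp hpD))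
    (fun p hp hpD i j hij => by
      rw [show a i * primorial D * (a j * n₀ + b j) - a j * primorial D * (a i * n₀ + b i) =
        (a i * b j - a j * b i) * primorial D by ring]
      exact (Nat.prime_iff_prime_int.1 hp).not_dvd_mul
        (not_dvd_of_natAbs_lt (hdet i j hij) ((hDdet i j).trans_lt hpD)) (hpW p hp hpD))
    fun p hp hpD t => by
      rw [← hform]
      refine hn₀ p hp hpD _ ?_
      have := (Nat.modEq_zero_iff_dvd.2
        ((hp.dvd_primorial_iff.2 hpD).mul_right t)).add_left n₀
      simpa using this
  simp only [← hform] at h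
  exact exists_le_card_of_progression (P := fun n : ℕ => 0 < ∏ i, (a i * n + b i) ∧
    (∏ i, (a i * n + b i)).natAbs.primeFactorsList.length ≤ 27) hW hc h
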